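/- arXiv:2201.08168 — 7 statements merged into one kernel-verified Lean document; each statement's English description precedes it below -/
import Mathlib

section
/- Fix an integer k ≥ 1 and let a_k(n) be defined by a_k(0) = 1 and a_k(n+1) = Σ_{0 ≤ i ≤ n, k | i} a_k(i)·a_k(n−i). Then for all m ≥ 0 and 0 ≤ j < k, a_k(km + j) = ((j+1)/(km+j+1))·binom((k+1)m + j, km + j). In particular a_k(km) = (1/(km+1))·binom((k+1)m, m), the m-th Fuss–Catalan number C_m^{k+1}. -/
/-- The Raney numbers `r / ((k + 1) * m + r) * ((k + 1) * m + r).choose m`, written without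
division. -/
def raney (k : ℕ) : ℕ → ℕ → ℚ
  | 0, _ => 1
  | m + 1, r => (((k + 1) * m + k + r).choose (m + 1) : ℚ) - k * ((k + 1) * m + k + r).choose m

theorem raney_succ_zero (k m : ℕ) : raney k (m + 1) 0 = 0 := by
  have h := Nat.choose_succ_right_eq ((k + 1) * m + k) m
  have hsub : (k + 1) * m + k - m = k * (m + 1) := by
    rw [Nat.sub_eq_iff_eq_add (by nlinarith)]; ring
  rw [hsub] at h
  have hq : (((k + 1) * m + k).choose (m + 1) : ℚ) * (m + 1) =
      ((k + 1) * m + k).choose m * (k * (m + 1)) := by exact_mod_cast h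
  have hm : (m + 1 : ℚ) ≠ 0 := by positivity
  simp only [raney, add_zero]
  apply mul_right_cancel₀ hm
  linear_combination hq

theorem raney_succ_succ (k m r : ℕ) :
    raney k (m + 1) (r + 1) = raney k (m + 1) r + raney k m (r + (k + 1)) := by
  cases m with
  | zero => simp [raney]
  | succ m =>
    have e : (k + 1) * m + k + (r + (k + 1)) = (k + 1) * (m + 1) + k + r := by ring
    simp only [raney, e]
    rw [← add_assoc, Nat.choose_succ_succ' _ (m + 1), Nat.choose_succ_succ' _ m]
    push_cast
    ring

theorem sum_raney_mul_raney (k s m r : ℕ) :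
    ∑ i ∈ Finset.range (m + 1), raney k i s * raney k (m - i) r = raney k m (s + r) := by
  induction m generalizing r with
  | zero => simp [raney]
  | succ m ihm =>
    have hsplit (r : ℕ) :
        ∑ i ∈ Finset.range (m + 1 + 1), raney k i s * raney k (m + 1 - i) r =
          ∑ i ∈ Finset.range (m + 1), raney k i s * raney k (m - i + 1) r +
            raney k (m + 1) s := by
      rw [Finset.sum_range_succ, Nat.sub_self]
      congr 1
      · refine Finset.sum_congr rfl fun i hi => ?_
        rw [Nat.sub_add_comm (Nat.lt_succ_iff.mp (Finset.mem_range.mp hi))]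
      · simp [raney]
    induction r with
    | zero => simp [hsplit, raney_succ_zero]
    | succ r ihr =>
      rw [hsplit] at ihr ⊢
      simp only [raney_succ_succ, mul_add, Finset.sum_add_distrib, ihm]
      rw [← add_assoc s r 1, raney_succ_succ, ← ihr, add_assoc s r]
      ring

theorem raney_one_succ (k m : ℕ) : raney k (m + 1) 1 = raney k m (k + 1) := by
  simpa [raney_succ_zero] using raney_succ_succ k m 0

theorem raney_eq_div_mul_choose (k m j : ℕ) :
    raney k m (j + 1) =
      (j + 1) / (k * m + j + 1) * (((k + 1) * m + j).choose (k * m + j)) := by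
  have hsymm : ((k + 1) * m + j).choose (k * m + j) = ((k + 1) * m + j).choose m :=
    Nat.choose_symm_of_eq_add (by ring)
  rw [hsymm]
  cases m with
  | zero =>
    have : (j + 1 : ℚ) ≠ 0 := by positivity
    simp [raney, this]
  | succ m =>
    have e : (k + 1) * m + k + (j + 1) = (k + 1) * (m + 1) + j := by ring
    have h := Nat.choose_succ_right_eq ((k + 1) * (m + 1) + j) m
    have hsub : (k + 1) * (m + 1) + j - m = k * (m + 1) + j + 1 := by
      rw [Nat.sub_eq_iff_eq_add (by nlinarith)]; ring
    rw [hsub] at h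
    have hq : (((k + 1) * (m + 1) + j).choose (m + 1) : ℚ) * (m + 1) =
        ((k + 1) * (m + 1) + j).choose m * (k * (m + 1) + j + 1) := by exact_mod_cast h
    have hK : (k * (m + 1) + j + 1 : ℚ) ≠ 0 := by positivity
    simp only [raney, e]
    push_cast
    rw [div_mul_eq_mul_div, eq_div_iff hK]
    linear_combination (k : ℚ) * hq

theorem sum_range_ite_dvd {M : Type*} [AddCommMonoid M] {k j : ℕ} (m : ℕ) (hj : j < k)
    (f : ℕ → M) :
    ∑ i ∈ Finset.range (k * m + j + 1), (if k ∣ i then f i else 0) =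
      ∑ i ∈ Finset.range (m + 1), f (k * i) := by
  have hk : 0 < k := by lia
  rw [← Finset.sum_filter]
  symm
  refine Finset.sum_nbij (k * ·) (fun i hi => ?_) (fun x _ y _ h => ?_) (fun i hi => ?_)
    fun _ _ => rfl
  · have : k * i ≤ k * m := Nat.mul_le_mul_left k (Nat.lt_succ_iff.mp (Finset.mem_range.mp hi))
    simp only [Finset.mem_filter, Finset.mem_range, dvd_mul_right, and_true]
    lia
  · exact Nat.eq_of_mul_eq_mul_left hk h
  · simp only [Finset.coe_filter, Finset.mem_range, Set.mem_ofPred_eq] at hi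
    obtain ⟨hi, c, rfl⟩ := hi
    refine ⟨c, ?_, rfl⟩
    have : k * c < k * (m + 1) := by rw [mul_add]; lia
    simpa using Nat.lt_of_mul_lt_mul_left this

theorem eq_raney_of_recurrence {k : ℕ} {a : ℕ → ℕ} (ha0 : a 0 = 1)
    (harec : ∀ n : ℕ,
      a (n + 1) = ∑ i ∈ Finset.range (n + 1), if k ∣ i then a i * a (n - i) else 0)
    (m j : ℕ) (hj : j < k) : (a (k * m + j) : ℚ) = raney k m (j + 1) := by
  induction hn : k * m + j using Nat.strong_induction_on generalizing m j with
  | _ n ih =>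
    have step (m j : ℕ) (hj : j < k) (hlt : k * m + j < n) :
        (a (k * m + j + 1) : ℚ) = raney k m (j + 2) := by
      rw [harec, sum_range_ite_dvd m hj, show j + 2 = 1 + (j + 1) by ring,
        ← sum_raney_mul_raney]
      push_cast
      refine Finset.sum_congr rfl fun i hi => ?_
      have him : i ≤ m := Nat.lt_succ_iff.mp (Finset.mem_range.mp hi)
      obtain ⟨d, rfl⟩ := Nat.exists_eq_add_of_le him
      rw [mul_add] at hlt
      have e : k * (i + d) + j - k * i = k * d + j := by rw [mul_add]; lia
      rw [e, Nat.add_sub_cancel_left, ih (k * i) (by lia) i 0 (by lia) rfl,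
        ih (k * d + j) (by lia) d j hj rfl]
    subst hn
    cases j with
    | succ j => exact step m j (by lia) (by lia)
    | zero =>
      cases m with
      | zero => simp [ha0, raney]
      | succ m =>
        obtain ⟨l, rfl⟩ := Nat.exists_eq_add_of_lt hj
        have h := step m l (by lia) (by rw [mul_add]; lia)
        rw [show (0 + l + 1) * (m + 1) + 0 = (0 + l + 1) * m + l + 1 by ring, h,
          raney_one_succ]
        congr 1
        lia

theorem fuss_catalan_closed_form (k : ℕ) (hk : 1 ≤ k) (a : ℕ → ℕ) (ha0 : a 0 = 1)
    (harec : ∀ n : ℕ,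
      a (n + 1) = ∑ i ∈ Finset.range (n + 1), if k ∣ i then a i * a (n - i) else 0) :
    (∀ m j : ℕ, j < k →
      (a (k * m + j) : ℚ) =
        (j + 1) / (k * m + j + 1) * (((k + 1) * m + j).choose (k * m + j))) ∧
    (∀ m : ℕ, (a (k * m) : ℚ) = 1 / (k * m + 1) * (((k + 1) * m).choose m)) := by
  have main (m j : ℕ) (hj : j < k) := (eq_raney_of_recurrence ha0 harec m j hj).trans
    (raney_eq_div_mul_choose k m j)
  refine ⟨main, fun m => ?_⟩
  have hsymm : ((k + 1) * m).choose (k * m) = ((k + 1) * m).choose m :=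
    Nat.choose_symm_of_eq_add (by ring)
  simpa [hsymm] using main m 0 hk
end

section
/- Let k ≥ 2 and set a(n) := mp_{213}(n,k), the number of mod-k-alternating permutations of [n] avoiding the pattern 213 (with a(0) := 1). Then for all n ≥ 0, a(n+1) = Σ_{0 ≤ j ≤ n, k | j} a(j)·a(n−j). -/
open Finset

/-- A permutation `π` of `Fin n` contains the length-3 pattern `σ`
(given as a permutation of `Fin 3`, read as the word `σ 0, σ 1, σ 2`). -/
def Pattern3 {n : ℕ} (σ : Equiv.Perm (Fin 3)) (π : Equiv.Perm (Fin n)) : Prop :=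
  ∃ f : Fin 3 → Fin n, StrictMono f ∧ ∀ a b : Fin 3, σ a < σ b ↔ π (f a) < π (f b)

/-- The pattern 123. -/
def pat123 : Equiv.Perm (Fin 3) := 1
/-- The pattern 132. -/
def pat132 : Equiv.Perm (Fin 3) := Equiv.swap 1 2
/-- The pattern 213. -/
def pat213 : Equiv.Perm (Fin 3) := Equiv.swap 0 1
/-- The pattern 231. -/
def pat231 : Equiv.Perm (Fin 3) := finRotate 3
/-- The pattern 312. -/
def pat312 : Equiv.Perm (Fin 3) := (finRotate 3)⁻¹
/-- The pattern 321. -/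
def pat321 : Equiv.Perm (Fin 3) := Equiv.swap 0 2

/-- Mod-k-alternating: `π(i) ≡ i (mod k)` (1-based; equivalently 0-based). -/
def ModKAlt {n : ℕ} (k : ℕ) (π : Equiv.Perm (Fin n)) : Prop :=
  ∀ i : Fin n, (π i : ℕ) % k = (i : ℕ) % k

/-- `π(i) ≡ r + i − 1 (mod k)` for all `i ∈ [n]` (1-based). -/
def ModKAltR {n : ℕ} (k r : ℕ) (π : Equiv.Perm (Fin n)) : Prop :=
  ∀ i : Fin n, ((π i : ℕ) + 1) % k = (r + (i : ℕ)) % k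

/-- `mp_σ(n,k)`: number of mod-k-alternating permutations of `[n]` avoiding `σ`. -/
noncomputable def mpPat (k : ℕ) (σ : Equiv.Perm (Fin 3)) (n : ℕ) : ℕ :=
  Nat.card {π : Equiv.Perm (Fin n) // ModKAlt k π ∧ ¬ Pattern3 σ π}

/-- `mp_σ(n,k,r)`: number of permutations in `MP(n,k,r)` avoiding `σ`. -/
noncomputable def mpPatR (k r : ℕ) (σ : Equiv.Perm (Fin 3)) (n : ℕ) : ℕ :=
  Nat.card {π : Equiv.Perm (Fin n) // ModKAltR k r π ∧ ¬ Pattern3 σ π}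

/-- `mp_{σ,τ}(n,k)`: number of mod-k-alternating permutations of `[n]` avoiding both `σ` and `τ`. -/
noncomputable def mpPat2 (k : ℕ) (σ τ : Equiv.Perm (Fin 3)) (n : ℕ) : ℕ :=
  Nat.card {π : Equiv.Perm (Fin n) // ModKAlt k π ∧ ¬ Pattern3 σ π ∧ ¬ Pattern3 τ π}

/-- The revflip involution: `revflip(π)(i) = n + 1 − π(n + 1 − i)` (1-based). -/
def revflip {n : ℕ} (π : Equiv.Perm (Fin n)) : Equiv.Perm (Fin n) :=
  (Fin.revPerm.trans π).trans Fin.revPerm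

/-- Explicit form of 213-avoidance. -/
def Avoids213 {n : ℕ} (π : Equiv.Perm (Fin n)) : Prop :=
  ∀ a b c : Fin n, a < b → b < c → π b < π a → ¬ π a < π c

theorem not_pattern3_pat213_iff {n : ℕ} (π : Equiv.Perm (Fin n)) :
    ¬ Pattern3 pat213 π ↔ Avoids213 π := by
  constructor
  · intro h a b c hab hbc hba hac
    refine h ⟨![a, b, c], ?_, ?_⟩
    · intro i j hij
      fin_cases i <;> fin_cases j <;> simp_all
      exact hab.trans hbc
    · have hbc' := hba.trans hac
      intro i j
      fin_cases i <;> fin_cases j <;>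
        simp [pat213, Equiv.swap_apply_def, hba, hac, hbc', hba.le, hac.le, hbc'.le]
  · rintro h ⟨f, hf, hp⟩
    refine h (f 0) (f 1) (f 2) (hf (by decide)) (hf (by decide)) ?_ ?_
    · exact (hp 1 0).1 (by decide)
    · exact (hp 0 2).1 (by decide)

/-- `π(i) = i + r` in `ZMod k` (0-based). -/
def HasShift {n : ℕ} (k : ℕ) (r : ZMod k) (π : Equiv.Perm (Fin n)) : Prop :=
  ∀ i : Fin n, ((π i : ℕ) : ZMod k) = (i : ℕ) + r

theorem modKAlt_iff_hasShift {n : ℕ} (k : ℕ) (π : Equiv.Perm (Fin n)) :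
    ModKAlt k π ↔ HasShift k 0 π := by
  simp only [ModKAlt, HasShift, add_zero, ZMod.natCast_eq_natCast_iff']

/-- The number of 213-avoiding permutations of `Fin n` with shift `r` modulo `k`. -/
noncomputable def shiftCount (k : ℕ) (r : ZMod k) (n : ℕ) : ℕ :=
  Nat.card {π : Equiv.Perm (Fin n) // HasShift k r π ∧ Avoids213 π}

theorem mpPat_pat213_eq (k n : ℕ) : mpPat k pat213 n = shiftCount k 0 n := by
  simp only [mpPat, shiftCount, modKAlt_iff_hasShift, not_pattern3_pat213_iff]

theorem shiftCount_zero (k : ℕ) (r : ZMod k) : shiftCount k r 0 = 1 := by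
  rw [shiftCount, Nat.card_eq_one_iff_unique]
  exact ⟨inferInstance, ⟨⟨1, fun i => i.elim0, fun i => i.elim0⟩⟩⟩

section Glue

variable {p q : ℕ}

/-- The word `α 0 β`, with the letters of `α` raised above those of `β`. -/
def glueFun (α : Equiv.Perm (Fin p)) (β : Equiv.Perm (Fin q)) (i : Fin (p + q + 1)) :
    Fin (p + q + 1) :=
  if h : (i : ℕ) < p then ⟨α ⟨i, h⟩ + (q + 1), by omega⟩
  else if h' : (i : ℕ) = p then 0
  else ⟨β ⟨i - (p + 1), by omega⟩ + 1, by omega⟩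

theorem glueFun_injective (α : Equiv.Perm (Fin p)) (β : Equiv.Perm (Fin q)) :
    Function.Injective (glueFun α β) := by
  intro i j h
  have h' := congrArg Fin.val h
  unfold glueFun at h'
  apply Fin.ext
  split_ifs at h' <;> simp only [Fin.val_zero] at h' <;> try omega
  · have := α.injective (Fin.ext (by omega : (α ⟨i, _⟩ : ℕ) = α ⟨j, _⟩))
    simpa using this
  · have := β.injective (Fin.ext (by omega :
      (β ⟨i - (p + 1), _⟩ : ℕ) = β ⟨j - (p + 1), _⟩))
    simp only [Fin.mk.injEq] at this
    omega

/-- The permutation `α 0 β`, with the letters of `α` raised above those of `β`. -/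
noncomputable def glue (α : Equiv.Perm (Fin p)) (β : Equiv.Perm (Fin q)) :
    Equiv.Perm (Fin (p + q + 1)) :=
  Equiv.ofBijective (glueFun α β) (Finite.injective_iff_bijective.1 (glueFun_injective α β))

theorem glue_left (α : Equiv.Perm (Fin p)) (β : Equiv.Perm (Fin q)) (i : Fin (p + q + 1))
    (h : (i : ℕ) < p) : (glue α β i : ℕ) = α ⟨i, h⟩ + (q + 1) := by
  simp [glue, glueFun, h]

theorem glue_mid (α : Equiv.Perm (Fin p)) (β : Equiv.Perm (Fin q)) (i : Fin (p + q + 1))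
    (h : (i : ℕ) = p) : (glue α β i : ℕ) = 0 := by
  simp [glue, glueFun, h]

theorem glue_right (α : Equiv.Perm (Fin p)) (β : Equiv.Perm (Fin q)) (i : Fin (p + q + 1))
    (h : p < (i : ℕ)) : (glue α β i : ℕ) = β ⟨i - (p + 1), by omega⟩ + 1 := by
  simp [glue, glueFun, h.not_gt, h.ne']

theorem glue_left' (α : Equiv.Perm (Fin p)) (β : Equiv.Perm (Fin q)) (i : Fin p) :
    (glue α β ⟨i, by omega⟩ : ℕ) = α i + (q + 1) :=
  glue_left α β _ i.2

theorem glue_right' (α : Equiv.Perm (Fin p)) (β : Equiv.Perm (Fin q)) (i : Fin q) :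
    (glue α β ⟨p + 1 + i, by omega⟩ : ℕ) = β i + 1 := by
  rw [glue_right α β _ (by simp only; omega)]
  simp

theorem glue_injective :
    Function.Injective fun x : Equiv.Perm (Fin p) × Equiv.Perm (Fin q) => glue x.1 x.2 := by
  rintro ⟨α, β⟩ ⟨α', β'⟩ h
  simp only at h
  refine Prod.ext (Equiv.ext fun i => Fin.ext ?_) (Equiv.ext fun i => Fin.ext ?_)
  · have h1 := glue_left' α β i
    rw [h, glue_left'] at h1
    simp only
    omega
  · have h1 := glue_right' α β i
    rw [h, glue_right'] at h1
    simp only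
    omega

theorem avoids213_glue_iff (α : Equiv.Perm (Fin p)) (β : Equiv.Perm (Fin q)) :
    Avoids213 (glue α β) ↔ Avoids213 α ∧ Avoids213 β := by
  constructor
  · intro h
    refine ⟨fun a b c hab hbc hba hac => ?_, fun a b c hab hbc hba hac => ?_⟩
    · refine h ⟨a, by omega⟩ ⟨b, by omega⟩ ⟨c, by omega⟩ hab hbc ?_ ?_ <;>
        rw [Fin.lt_def, glue_left', glue_left'] <;> omega
    · refine h ⟨p + 1 + a, by omega⟩ ⟨p + 1 + b, by omega⟩ ⟨p + 1 + c, by omega⟩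
        (by rw [Fin.mk_lt_mk]; omega) (by rw [Fin.mk_lt_mk]; omega) ?_ ?_ <;>
        rw [Fin.lt_def, glue_right', glue_right'] <;> omega
  · rintro ⟨hα, hβ⟩ a b c hab hbc hba hac
    rw [Fin.lt_def] at hab hbc hba hac
    rcases lt_trichotomy (a : ℕ) p with ha | ha | ha
    · rw [glue_left α β a ha] at hba hac
      rcases lt_trichotomy (c : ℕ) p with hc | hc | hc
      · rw [glue_left α β c hc] at hac
        rw [glue_left α β b (by omega)] at hba
        exact hα ⟨a, ha⟩ ⟨b, by omega⟩ ⟨c, hc⟩ hab hbc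
          (by rw [Fin.lt_def]; omega) (by rw [Fin.lt_def]; omega)
      · rw [glue_mid α β c hc] at hac
        omega
      · rw [glue_right α β c hc] at hac
        omega
    · rw [glue_mid α β a ha] at hba
      omega
    · rw [glue_right α β a ha] at hba hac
      rw [glue_right α β b (by omega)] at hba
      rw [glue_right α β c (by omega)] at hac
      exact hβ ⟨a - (p + 1), by omega⟩ ⟨b - (p + 1), by omega⟩ ⟨c - (p + 1), by omega⟩
        (by rw [Fin.mk_lt_mk]; omega) (by rw [Fin.mk_lt_mk]; omega)
        (by rw [Fin.lt_def]; omega) (by rw [Fin.lt_def]; omega)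

theorem hasShift_glue_iff (k : ℕ) (r : ZMod k) (α : Equiv.Perm (Fin p))
    (β : Equiv.Perm (Fin q)) :
    HasShift k r (glue α β) ↔
      (p : ZMod k) + r = 0 ∧ HasShift k (-((p + q + 1 : ℕ) : ZMod k)) α ∧ HasShift k 0 β := by
  constructor
  · intro h
    have hp : (p : ZMod k) + r = 0 := by
      have := h ⟨p, by omega⟩
      rw [glue_mid α β _ rfl] at this
      simpa using this.symm
    refine ⟨hp, fun i => ?_, fun i => ?_⟩
    · have := h ⟨i, by omega⟩
      rw [glue_left'] at this
      push_cast at this ⊢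
      linear_combination this + hp
    · have := h ⟨p + 1 + i, by omega⟩
      rw [glue_right'] at this
      push_cast at this ⊢
      linear_combination this + hp
  · rintro ⟨hp, hα, hβ⟩ i
    rcases lt_trichotomy (i : ℕ) p with hi | hi | hi
    · have := hα ⟨i, hi⟩
      rw [glue_left α β i hi]
      push_cast at this ⊢
      linear_combination this - hp
    · rw [glue_mid α β i hi, hi, hp, Nat.cast_zero]
    · have := hβ ⟨i - (p + 1), by omega⟩
      rw [glue_right α β i hi]
      simp only [Nat.cast_sub (show p + 1 ≤ (i : ℕ) from hi)] at this
      push_cast at this ⊢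
      linear_combination this - hp

theorem exists_glue_eq (π : Equiv.Perm (Fin (p + q + 1))) (h0 : π ⟨p, by omega⟩ = 0)
    (hπ : Avoids213 π) : ∃ α β, glue α β = π := by
  have pos : ∀ i : Fin (p + q + 1), (i : ℕ) ≠ p → 0 < π i := by
    intro i hi
    rw [Fin.pos_iff_ne_zero, ← h0]
    exact fun h => hi (congrArg Fin.val (π.injective h))
  have sep : ∀ i j : Fin (p + q + 1), (i : ℕ) < p → p < (j : ℕ) → π j < π i := by
    intro i j hi hj
    have h1 := hπ i ⟨p, by omega⟩ j hi hj (by rw [h0]; exact pos i hi.ne)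
    refine lt_of_le_of_ne (not_lt.1 h1) fun h => ?_
    have := congrArg Fin.val (π.injective h)
    omega
  have hl : ∀ i : Fin (p + q + 1), (i : ℕ) < p → q + 1 ≤ (π i : ℕ) := by
    intro i hi
    have := Finset.card_le_card_of_injOn (s := Finset.Ici (⟨p, by omega⟩ : Fin (p + q + 1)))
      (t := Finset.Iio (π i)) π (fun j hj => ?_) π.injective.injOn
    · simp only [Fin.card_Ici, Fin.card_Iio] at this
      omega
    · simp only [Finset.coe_Ici, Set.mem_Ici, Finset.coe_Iio, Set.mem_Iio] at hj ⊢
      rcases hj.eq_or_lt with rfl | hj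
      · rw [h0]
        exact pos i hi.ne
      · exact sep i j hi hj
  have hr : ∀ j : Fin (p + q + 1), p < (j : ℕ) → (π j : ℕ) ≤ q := by
    intro j hj
    have := Finset.card_le_card_of_injOn (s := Finset.Iio (⟨p, by omega⟩ : Fin (p + q + 1)))
      (t := Finset.Ioi (π j)) π (fun i hi => ?_) π.injective.injOn
    · simp only [Fin.card_Iio, Fin.card_Ioi] at this
      omega
    · simp only [Finset.coe_Iio, Set.mem_Iio, Finset.coe_Ioi, Set.mem_Ioi] at hi ⊢
      exact sep i j hi hj
  let f : Fin p → Fin p := fun i => ⟨π ⟨i, by omega⟩ - (q + 1), by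
    have := i.2
    omega⟩
  let g : Fin q → Fin q := fun i => ⟨π ⟨p + 1 + i, by omega⟩ - 1, by
    have := hr ⟨p + 1 + i, by omega⟩ (by simp only; omega)
    have := i.2
    omega⟩
  have hf : Function.Injective f := by
    intro i j h
    have h1 := hl ⟨i, by omega⟩ i.2
    have h2 := hl ⟨j, by omega⟩ j.2
    simp only [f, Fin.mk.injEq] at h
    have := π.injective (Fin.ext (by omega :
      (π ⟨(i : ℕ), _⟩ : ℕ) = π ⟨(j : ℕ), _⟩))
    exact Fin.ext (by simpa using this)
  have hg : Function.Injective g := by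
    intro i j h
    have h1 := pos ⟨p + 1 + i, by omega⟩ (by simp only; omega)
    have h2 := pos ⟨p + 1 + j, by omega⟩ (by simp only; omega)
    rw [Fin.lt_def, Fin.val_zero] at h1 h2
    simp only [g, Fin.mk.injEq] at h
    have := congrArg Fin.val (π.injective
      (Fin.ext (by omega : (π ⟨p + 1 + i, _⟩ : ℕ) = π ⟨p + 1 + j, _⟩)))
    simp only at this
    omega
  refine ⟨Equiv.ofBijective f (Finite.injective_iff_bijective.1 hf),
    Equiv.ofBijective g (Finite.injective_iff_bijective.1 hg),
    Equiv.ext fun i => Fin.ext ?_⟩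
  rcases lt_trichotomy (i : ℕ) p with hi | hi | hi
  · rw [glue_left _ _ i hi]
    have := hl i hi
    simp only [f, Equiv.ofBijective_apply, Fin.eta]
    omega
  · rw [glue_mid _ _ i hi, show i = ⟨p, by omega⟩ from Fin.ext hi, h0, Fin.val_zero]
  · rw [glue_right _ _ i hi]
    have := pos i hi.ne'
    rw [Fin.lt_def, Fin.val_zero] at this
    simp only [g, Equiv.ofBijective_apply, show p + 1 + ((i : ℕ) - (p + 1)) = i by omega,
      Fin.eta]
    omega

theorem card_zero_at (k : ℕ) (r : ZMod k) :
    Nat.card {π : Equiv.Perm (Fin (p + q + 1)) //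
        (HasShift k r π ∧ Avoids213 π) ∧ π ⟨p, by omega⟩ = 0} =
      if (p : ZMod k) + r = 0 then
        shiftCount k (-((p + q + 1 : ℕ) : ZMod k)) p * shiftCount k 0 q else 0 := by
  split_ifs with hp
  · rw [shiftCount, shiftCount, ← Nat.card_prod]
    symm
    refine Nat.card_eq_of_bijective (fun x => ⟨glue x.1.1 x.2.1,
      ⟨(hasShift_glue_iff k r _ _).2 ⟨hp, x.1.2.1, x.2.2.1⟩,
        (avoids213_glue_iff _ _).2 ⟨x.1.2.2, x.2.2.2⟩⟩, Fin.ext (glue_mid _ _ _ rfl)⟩) ⟨?_, ?_⟩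
    · rintro ⟨⟨α, hα⟩, ⟨β, hβ⟩⟩ ⟨⟨α', hα'⟩, ⟨β', hβ'⟩⟩ h
      have := @glue_injective p q (α, β) (α', β') (congrArg Subtype.val h)
      simp only [Prod.mk.injEq] at this
      obtain ⟨rfl, rfl⟩ := this
      rfl
    · rintro ⟨π, ⟨hs, ha⟩, h0⟩
      obtain ⟨α, β, rfl⟩ := exists_glue_eq π h0 ha
      have hs' := (hasShift_glue_iff k r _ _).1 hs
      have ha' := (avoids213_glue_iff _ _).1 ha
      exact ⟨(⟨α, hs'.2.1, ha'.1⟩, ⟨β, hs'.2.2, ha'.2⟩), rfl⟩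
  · rw [Nat.card_eq_zero]
    left
    constructor
    rintro ⟨π, ⟨hs, -⟩, h0⟩
    have := hs ⟨p, by omega⟩
    rw [h0] at this
    exact hp (by simpa using this.symm)

end Glue

theorem shiftCount_succ (k : ℕ) (r : ZMod k) (n : ℕ) :
    shiftCount k r (n + 1) = ∑ x ∈ antidiagonal n, if (x.1 : ZMod k) + r = 0 then
      shiftCount k (-((n + 1 : ℕ) : ZMod k)) x.1 * shiftCount k 0 x.2 else 0 := by
  let S := {π : Equiv.Perm (Fin (n + 1)) // HasShift k r π ∧ Avoids213 π}
  have e : S ≃ Σ i : Fin (n + 1), {x : S // x.1.symm 0 = i} :=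
    (Equiv.sigmaFiberEquiv fun x : S => x.1.symm 0).symm
  rw [shiftCount, Nat.card_congr e, Nat.card_sigma, Finset.Nat.sum_antidiagonal_eq_sum_range_succ_mk,
    Finset.sum_range]
  refine Finset.sum_congr rfl fun i _ => ?_
  obtain ⟨p, hp⟩ := i
  obtain ⟨q, rfl⟩ := Nat.exists_eq_add_of_le (Nat.lt_succ_iff.1 hp)
  simp only [Nat.add_sub_cancel_left]
  rw [← card_zero_at]
  refine Nat.card_congr ((Equiv.subtypeSubtypeEquivSubtypeInter _
    fun π : Equiv.Perm (Fin (p + q + 1)) => π.symm 0 = ⟨p, hp⟩).trans (Equiv.subtypeEquivRight fun π => and_congr_right fun _ => ?_))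
  rw [Equiv.symm_apply_eq, eq_comm]

/-- The solution of the recursion `c(n+1) = ∑_{k ∣ j} c(j) c(n-j)` with `c(0) = 1`. -/
def convSeq (k : ℕ) : ℕ → ℕ
  | 0 => 1
  | n + 1 => ∑ j : Fin (n + 1), if k ∣ j then convSeq k j * convSeq k (n - j) else 0

theorem convSeq_succ (k n : ℕ) : convSeq k (n + 1) =
    ∑ x ∈ antidiagonal n, if (x.1 : ZMod k) = 0 then convSeq k x.1 * convSeq k x.2 else 0 := by
  rw [convSeq, Finset.Nat.sum_antidiagonal_eq_sum_range_succ_mk, Finset.sum_range]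
  simp only [ZMod.natCast_eq_zero_iff]

/-- The part of the generating function of `convSeq k` with exponents `≡ s` modulo `k`. -/
noncomputable def convPart (k : ℕ) (s : ZMod k) : PowerSeries ℕ :=
  PowerSeries.mk fun n => if (n : ZMod k) = s then convSeq k n else 0

theorem convPart_add_one (k : ℕ) (s : ZMod k) (hs : s + 1 ≠ 0) :
    convPart k (s + 1) = PowerSeries.X * (convPart k 0 * convPart k s) := by
  ext n
  cases n with
  | zero => simp [convPart, hs.symm]
  | succ n =>
    rw [PowerSeries.coeff_succ_X_mul, PowerSeries.coeff_mul]
    simp only [convPart, PowerSeries.coeff_mk, Nat.cast_add, Nat.cast_one, add_left_inj,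
      convSeq_succ]
    split_ifs with h
    · refine Finset.sum_congr rfl fun x hx => ?_
      rw [← mem_antidiagonal.1 hx, Nat.cast_add] at h
      by_cases hx0 : (x.1 : ZMod k) = 0
      · rw [hx0, zero_add] at h
        simp [hx0, h]
      · simp [hx0]
    · refine (Finset.sum_eq_zero fun x hx => ?_).symm
      rw [← mem_antidiagonal.1 hx, Nat.cast_add] at h
      by_cases hx0 : (x.1 : ZMod k) = 0
      · rw [hx0, zero_add] at h
        simp [h]
      · simp [hx0]

/-- The products of complementary parts all agree. -/
theorem convPart_mul_convPart (k : ℕ) [NeZero k] (s : ZMod k) :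
    convPart k s * convPart k (-1 - s) = convPart k 0 * convPart k (-1) := by
  obtain ⟨t, rfl⟩ := ZMod.natCast_zmod_surjective s
  induction t with
  | zero => simp
  | succ t ih =>
    by_cases h : (t : ZMod k) + 1 = 0
    · simp [h]
    · have h' : (-1 - ((t + 1 : ℕ) : ZMod k)) + 1 ≠ 0 := by
        intro h0
        apply h
        push_cast at h0
        linear_combination -h0
      have h1 := convPart_add_one k _ h'
      rw [show (-1 - ((t + 1 : ℕ) : ZMod k)) + 1 = -1 - t by push_cast; ring] at h1
      rw [← ih, h1, Nat.cast_succ, convPart_add_one k _ h]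
      ring

theorem sum_antidiagonal_convSeq (k : ℕ) [NeZero k] (n : ℕ) (hn : ((n + 1 : ℕ) : ZMod k) = 0)
    (r : ZMod k) :
    (∑ x ∈ antidiagonal n, if (x.1 : ZMod k) + r = 0 then convSeq k x.1 * convSeq k x.2 else 0) =
      convSeq k (n + 1) := by
  have key : ∀ s : ZMod k, PowerSeries.coeff n (convPart k s * convPart k (-1 - s)) =
      ∑ x ∈ antidiagonal n,
        if (x.1 : ZMod k) = s then convSeq k x.1 * convSeq k x.2 else 0 := by
    intro s
    rw [PowerSeries.coeff_mul]
    refine Finset.sum_congr rfl fun x hx => ?_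
    simp only [convPart, PowerSeries.coeff_mk]
    by_cases h : (x.1 : ZMod k) = s
    · have h2 : (x.2 : ZMod k) = -1 - s := by
        rw [← mem_antidiagonal.1 hx] at hn
        push_cast at hn
        linear_combination hn - h
      simp [h, h2]
    · simp [h]
  simp only [add_eq_zero_iff_eq_neg]
  rw [convSeq_succ, ← key, ← key, convPart_mul_convPart, convPart_mul_convPart]

theorem shiftCount_eq_convSeq (k : ℕ) [NeZero k] (m : ℕ) :
    shiftCount k 0 m = convSeq k m ∧
      ∀ r : ZMod k, (m : ZMod k) = 0 → shiftCount k r m = convSeq k m := by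
  induction m using Nat.strong_induction_on with
  | _ m ih =>
    cases m with
    | zero => simp [shiftCount_zero, convSeq]
    | succ n =>
      have h1 : ∀ x ∈ antidiagonal n, shiftCount k 0 x.1 = convSeq k x.1 := fun x hx =>
        (ih x.1 (Finset.Nat.antidiagonal.fst_lt hx)).1
      have h2 : ∀ x ∈ antidiagonal n, shiftCount k 0 x.2 = convSeq k x.2 := fun x hx =>
        (ih x.2 (Finset.Nat.antidiagonal.snd_lt hx)).1
      refine ⟨?_, fun r hn => ?_⟩
      · rw [shiftCount_succ, convSeq_succ]
        refine Finset.sum_congr rfl fun x hx => ?_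
        rw [add_zero, h2 x hx]
        split_ifs with h
        · rw [(ih x.1 (Finset.Nat.antidiagonal.fst_lt hx)).2 _ h]
        · rfl
      · rw [shiftCount_succ, ← sum_antidiagonal_convSeq k n hn r, hn, neg_zero]
        refine Finset.sum_congr rfl fun x hx => ?_
        rw [h1 x hx, h2 x hx]

theorem mp213_recursion (k : ℕ) (hk : 2 ≤ k) :
    mpPat k pat213 0 = 1 ∧
    ∀ n : ℕ, mpPat k pat213 (n + 1) =
      ∑ j ∈ Finset.range (n + 1),
        if k ∣ j then mpPat k pat213 j * mpPat k pat213 (n - j) else 0 := by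
  have : NeZero k := ⟨by omega⟩
  refine ⟨by rw [mpPat_pat213_eq, shiftCount_zero], fun n => ?_⟩
  simp only [mpPat_pat213_eq, (shiftCount_eq_convSeq k _).1]
  rw [convSeq, Finset.sum_range]
end

section
/- Let σ ∈ {132, 213}, let k ≥ 2 and n ≥ 1, and write n = km + j with 0 ≤ j < k. Then mp_σ(n,k) = ((j+1)/(km+j+1))·binom((k+1)m + j, km + j). In particular mp_σ(km,k) = (1/(km+1))·binom((k+1)m, m), the m-th Fuss–Catalan number. -/
open Finset

/-- Coefficients of the powers of the Fuss–Catalan series: `fussCatalan k m r` is the coefficient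
of `X ^ m` in `B ^ r`, where `B = 1 + X * B ^ (k + 1)`. -/
def fussCatalan (k : ℕ) : ℕ → ℕ → ℕ
  | 0, _ => 1
  | _ + 1, 0 => 0
  | m + 1, r + 1 => fussCatalan k (m + 1) r + fussCatalan k m (r + (k + 1))

theorem fussCatalan_mul_eq (k m r : ℕ) :
    (((k + 1) * m + r : ℕ) : ℚ) * fussCatalan k m r = r * ((k + 1) * m + r).choose m := by
  induction m generalizing r with
  | zero => simp [fussCatalan]
  | succ m ihm =>
    induction r with
    | zero => simp [fussCatalan]
    | succ r ihr =>
      have h2 := ihm (r + (k + 1))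
      have e : (k + 1) * m + (r + (k + 1)) = (k + 1) * (m + 1) + r := by ring
      rw [e] at h2
      set T := (k + 1) * (m + 1) + r with hT
      have hTQ : (T : ℚ) = (k + 1) * (m + 1) + r := by rw [hT]; push_cast; ring
      have hT0 : (T : ℚ) ≠ 0 := by rw [hTQ]; positivity
      have hmT : m ≤ T := by rw [hT]; nlinarith [Nat.zero_le (k * m)]
      have hc : (T.choose (m + 1) : ℚ) * (m + 1) = T.choose m * (T - m) := by
        have := Nat.choose_succ_right_eq T m
        rw [← Nat.cast_sub hmT]
        exact_mod_cast this
      rw [← add_assoc, ← hT, Nat.choose_succ_succ, fussCatalan]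
      apply mul_left_cancel₀ hT0
      push_cast at h2 ⊢
      linear_combination (T + 1 : ℚ) * ihr + (T + 1 : ℚ) * h2 - (k + 1 : ℚ) * hc
        - ((T.choose (m + 1) : ℚ) + T.choose m) * hTQ

theorem fussCatalan_succ_eq (k m j : ℕ) :
    (fussCatalan k m (j + 1) : ℚ) =
      (j + 1) / (k * m + j + 1) * (((k + 1) * m + j).choose (k * m + j)) := by
  have h := fussCatalan_mul_eq k m (j + 1)
  have hs : ((k + 1) * m + j).choose (k * m + j) = ((k + 1) * m + j).choose m :=
    Nat.choose_symm_of_eq_add (by ring)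
  have hc := Nat.choose_mul_succ_eq ((k + 1) * m + j) m
  have e : (k + 1) * m + j + 1 - m = k * m + j + 1 := by
    have : (k + 1) * m = k * m + m := by ring
    omega
  rw [e] at hc
  have hc' : (((k + 1) * m + j).choose m : ℚ) * ((k + 1) * m + j + 1) =
      ((k + 1) * m + j + 1).choose m * (k * m + j + 1) := by exact_mod_cast hc
  rw [hs, div_mul_eq_mul_div, eq_div_iff (by positivity)]
  have h0 : ((k + 1) * m + j + 1 : ℚ) ≠ 0 := by positivity
  apply mul_left_cancel₀ h0
  rw [← add_assoc] at h
  push_cast at h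
  linear_combination (k * m + j + 1 : ℚ) * h - (j + 1 : ℚ) * hc'

theorem sum_antidiagonal_fussCatalan_mul (k m r s : ℕ) :
    ∑ x ∈ antidiagonal m, fussCatalan k x.1 r * fussCatalan k x.2 s = fussCatalan k m (r + s) := by
  induction m generalizing r s with
  | zero => simp [fussCatalan]
  | succ m ihm =>
    induction r with
    | zero =>
      rw [Finset.Nat.sum_antidiagonal_succ]
      simp [fussCatalan]
    | succ r ihr =>
      rw [Finset.Nat.sum_antidiagonal_succ] at ihr ⊢
      have e : r + 1 + s = (r + s) + 1 := by ring
      have e' : r + s + (k + 1) = r + (k + 1) + s := by ring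
      rw [e, fussCatalan.eq_3, ← ihr, e', ← ihm]
      simp only [fussCatalan, add_mul, Finset.sum_add_distrib]
      ring

/-- The word `l` contains no occurrence of the pattern 132. -/
def Avoids132 (l : List ℕ) : Prop :=
  ∀ a b c : ℕ, a < b → b < c → ¬ [a, c, b].Sublist l

/-- The `i`-th letter of the word (0-based) is congruent to `r + i` modulo `k`. -/
def ShiftedAlt (k : ℕ) : ℕ → List ℕ → Prop
  | _, [] => True
  | r, a :: l => a ≡ r [MOD k] ∧ ShiftedAlt k (r + 1) l

theorem shiftedAlt_append {k r : ℕ} {l l' : List ℕ} :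
    ShiftedAlt k r (l ++ l') ↔ ShiftedAlt k r l ∧ ShiftedAlt k (r + l.length) l' := by
  induction l generalizing r with
  | nil => simp [ShiftedAlt]
  | cons a l ih => simp [ShiftedAlt, ih, and_assoc, add_assoc, add_comm 1]

theorem shiftedAlt_map_add {k q r s : ℕ} {l : List ℕ} (h : q + s ≡ r [MOD k]) :
    ShiftedAlt k r (l.map (· + q)) ↔ ShiftedAlt k s l := by
  induction l generalizing r s with
  | nil => simp [ShiftedAlt]
  | cons a l ih =>
    have h' : q + (s + 1) ≡ r + 1 [MOD k] := h.add_right 1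
    simp only [List.map_cons, ShiftedAlt, ih h']
    refine and_congr_left fun _ => ⟨fun H => ?_, fun H => ?_⟩
    · exact Nat.ModEq.add_right_cancel' q (H.trans (h.symm.trans (by rw [add_comm])))
    · exact (H.add_right q).trans (by rw [add_comm]; exact h)

theorem shiftedAlt_congr {k r s : ℕ} {l : List ℕ} (h : r ≡ s [MOD k]) :
    ShiftedAlt k r l ↔ ShiftedAlt k s l := by
  simpa using shiftedAlt_map_add (q := 0) (l := l) (s := s) (r := r) (by simpa using h.symm)

theorem shiftedAlt_iff_getElem {k r : ℕ} {l : List ℕ} :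
    ShiftedAlt k r l ↔ ∀ (i : ℕ) (h : i < l.length), l[i] ≡ r + i [MOD k] := by
  induction l generalizing r with
  | nil => simp [ShiftedAlt]
  | cons a l ih =>
    simp only [ShiftedAlt, ih]
    constructor
    · rintro ⟨h0, h⟩ (_ | i) hi
      · simpa using h0
      · simpa [add_assoc, add_comm 1] using h i (by simpa using hi)
    · intro h
      refine ⟨h 0 (Nat.zero_lt_succ _), fun i hi => ?_⟩
      have := h (i + 1) (Nat.succ_lt_succ hi)
      rw [List.getElem_cons_succ] at this
      simpa [add_assoc, add_comm 1] using this

theorem avoids132_map_add {q : ℕ} {l : List ℕ} : Avoids132 (l.map (· + q)) ↔ Avoids132 l := by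
  constructor
  · intro h a b c hab hbc hs
    exact h (a + q) (b + q) (c + q) (by omega) (by omega) (hs.map (· + q))
  · intro h a b c hab hbc hs
    obtain ⟨u, hl', e⟩ := List.sublist_map_iff.1 hs
    obtain ⟨a', t, ht, rfl, e₁⟩ := List.map_eq_cons_iff.1 e.symm
    obtain ⟨c', t, rfl, rfl, e₂⟩ := List.map_eq_cons_iff.1 e₁
    obtain ⟨b', t, rfl, rfl, e₃⟩ := List.map_eq_cons_iff.1 e₂
    obtain rfl := List.map_eq_nil_iff.1 e₃
    subst ht
    exact h a' b' c' (by omega) (by omega) hl'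

theorem avoids132_append_cons {L R : List ℕ} {N : ℕ} (hL : ∀ x ∈ L, x < N) (hR : ∀ x ∈ R, x < N)
    (hLR : ∀ x ∈ L, ∀ y ∈ R, y ≤ x) :
    Avoids132 (L ++ N :: R) ↔ Avoids132 L ∧ Avoids132 R := by
  constructor
  · refine fun h => ⟨fun a b c hab hbc hs => h a b c hab hbc ?_,
      fun a b c hab hbc hs => h a b c hab hbc ?_⟩
    · exact hs.trans (List.sublist_append_left _ _)
    · exact hs.trans ((List.sublist_cons_self _ _).trans (List.sublist_append_right _ _))
  · rintro ⟨h1, h2⟩ a b c hab hbc hs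
    obtain ⟨l₁, l₂, e, hl₁, hl₂⟩ := List.sublist_append_iff.1 hs
    match l₁ with
    | [] =>
      obtain rfl : [a, c, b] = l₂ := by simpa using e
      rcases List.sublist_cons_iff.1 hl₂ with h | ⟨t, ht, h⟩
      · exact h2 a b c hab hbc h
      · simp only [List.cons.injEq] at ht
        obtain ⟨rfl, rfl⟩ := ht
        have := hR c (h.subset (by simp))
        omega
    | [x] =>
      simp only [List.cons_append, List.nil_append, List.cons.injEq] at e
      obtain ⟨rfl, rfl⟩ := e
      have ha : a ∈ L := hl₁.subset (by simp)
      have hb : b ∈ N :: R := hl₂.subset (by simp)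
      have hc : c ∈ N :: R := hl₂.subset (by simp)
      rcases List.mem_cons.1 hb with rfl | hb
      · rcases List.mem_cons.1 hc with rfl | hc
        · omega
        · have := hR c hc
          omega
      · have := hLR a ha b hb
        omega
    | [x, y] =>
      simp only [List.cons_append, List.nil_append, List.cons.injEq] at e
      obtain ⟨rfl, rfl, rfl⟩ := e
      have ha : a ∈ L := hl₁.subset (by simp)
      have hc : c ∈ L := hl₁.subset (by simp)
      have hb : b ∈ N :: R := hl₂.subset (by simp)
      rcases List.mem_cons.1 hb with rfl | hb
      · have := hL c hc
        omega
      · have := hLR a ha b hb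
        omega
    | x :: y :: z :: t =>
      simp only [List.cons_append, List.cons.injEq, List.nil_eq, List.append_eq_nil_iff] at e
      obtain ⟨rfl, rfl, rfl, rfl, rfl⟩ := e
      exact h1 _ _ _ hab hbc hl₁

/-- The words on `{0, …, N - 1}` using every letter once, avoiding 132, whose `i`-th letter is
congruent to `r + i` modulo `k`. -/
def altWords (k N r : ℕ) : Set (List ℕ) :=
  {l | l.Nodup ∧ (∀ x, x ∈ l ↔ x < N) ∧ Avoids132 l ∧ ShiftedAlt k r l}

theorem length_eq_of_mem_iff_lt {l : List ℕ} {N : ℕ} (hl : l.Nodup) (h : ∀ x, x ∈ l ↔ x < N) :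
    l.length = N := by
  rw [← List.toFinset_card_of_nodup hl, show l.toFinset = range N by ext; simp [h]]
  simp

theorem length_of_mem_altWords {k N r : ℕ} {l : List ℕ} (h : l ∈ altWords k N r) :
    l.length = N :=
  length_eq_of_mem_iff_lt h.1 h.2.1

theorem mem_iff_lt_length_of_lower {l : List ℕ} (hl : l.Nodup)
    (h : ∀ x ∈ l, ∀ y < x, y ∈ l) (x : ℕ) : x ∈ l ↔ x < l.length := by
  have key : ∀ x, x ∈ l → x < l.length := by
    intro x hx
    have hsub : range (x + 1) ⊆ l.toFinset := by
      intro y hy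
      rw [List.mem_toFinset]
      rcases (Nat.lt_succ_iff.1 (mem_range.1 hy)).lt_or_eq with hy | rfl
      · exact h x hx y hy
      · exact hx
    have := card_le_card hsub
    rw [card_range, List.toFinset_card_of_nodup hl] at this
    omega
  have hsub : l.toFinset ⊆ range l.length := by
    intro y hy
    exact mem_range.2 (key y (List.mem_toFinset.1 hy))
  have heq := eq_of_subset_of_card_le hsub (by rw [card_range, List.toFinset_card_of_nodup hl])
  rw [← List.mem_toFinset, heq, mem_range]

instance finite_altWords (k N r : ℕ) : Finite (altWords k N r) := by
  refine Set.Finite.subset (List.finite_toSet (List.range N).permutations) ?_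
  rintro l ⟨hl, h, -⟩
  rw [Set.mem_ofPred_eq, List.mem_permutations, List.perm_ext_iff_of_nodup hl List.nodup_range]
  simpa using h

theorem altWords_congr {k N r s : ℕ} (h : r ≡ s [MOD k]) : altWords k N r = altWords k N s := by
  ext l
  simp [altWords, shiftedAlt_congr h]

theorem altWords_zero (k r : ℕ) : altWords k 0 r = {[]} := by
  ext l
  constructor
  · rintro ⟨-, h, -⟩
    rw [Set.mem_singleton_iff, List.eq_nil_iff_forall_not_mem]
    simpa using h
  · rintro rfl
    refine ⟨by simp, by simp, fun a b c _ _ h => by simp at h, trivial⟩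

theorem append_cons_mem_altWords {k p q r : ℕ} (hqr : q ≡ r [MOD k]) {L R : List ℕ}
    (hL : L ∈ altWords k p 0) (hR : R ∈ altWords k q (p + q + 1)) :
    L.map (· + q) ++ (p + q) :: R ∈ altWords k (p + q + 1) r := by
  have hlen := length_of_mem_altWords hL
  obtain ⟨hL1, hL2, hL3, hL4⟩ := hL
  obtain ⟨hR1, hR2, hR3, hR4⟩ := hR
  refine ⟨?_, ?_, ?_, ?_⟩
  · rw [List.nodup_append]
    refine ⟨hL1.map (add_left_injective q), ?_, ?_⟩
    · rw [List.nodup_cons]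
      exact ⟨by rw [hR2]; omega, hR1⟩
    · intro a ha b hb
      obtain ⟨x, hx, rfl⟩ := List.mem_map.1 ha
      rw [hL2] at hx
      rw [List.mem_cons, hR2] at hb
      omega
  · intro x
    simp only [List.mem_append, List.mem_map, List.mem_cons, hL2, hR2]
    constructor
    · rintro (⟨a, ha, rfl⟩ | h | h) <;> omega
    · intro h
      by_cases h1 : x < q
      · exact Or.inr (Or.inr h1)
      by_cases h2 : x = p + q
      · exact Or.inr (Or.inl h2)
      · exact Or.inl ⟨x - q, by omega, by omega⟩
  · rw [avoids132_append_cons, avoids132_map_add]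
    · exact ⟨hL3, hR3⟩
    · intro x hx
      obtain ⟨z, hz, rfl⟩ := List.mem_map.1 hx
      rw [hL2] at hz
      omega
    · intro x hx
      rw [hR2] at hx
      omega
    · intro x hx y hy
      obtain ⟨z, hz, rfl⟩ := List.mem_map.1 hx
      rw [hR2] at hy
      omega
  · rw [shiftedAlt_append, ShiftedAlt, shiftedAlt_map_add (s := 0) (by simpa using hqr),
      List.length_map, hlen]
    have h : p + q ≡ r + p [MOD k] := by rw [add_comm p]; exact hqr.add_right p
    exact ⟨hL4, h, (shiftedAlt_congr (h.add_right 1)).1 hR4⟩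

theorem exists_append_cons_of_mem_altWords {k N r : ℕ} {l : List ℕ}
    (hl : l ∈ altWords k (N + 1) r) :
    ∃ p q, p + q = N ∧ q ≡ r [MOD k] ∧ ∃ L ∈ altWords k p 0, ∃ R ∈ altWords k q (N + 1),
      L.map (· + q) ++ N :: R = l := by
  have hlen := length_of_mem_altWords hl
  obtain ⟨h1, h2, h3, h4⟩ := hl
  obtain ⟨M, R, rfl⟩ := List.append_of_mem ((h2 N).2 (by omega))
  rw [List.nodup_append, List.nodup_cons] at h1
  obtain ⟨hM, ⟨hNR, hR⟩, hMR⟩ := h1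
  have hMN : ∀ x ∈ M, x < N := by
    intro x hx
    have := (h2 x).1 (by simp [hx])
    have := hMR x hx N (by simp)
    omega
  have hRN : ∀ x ∈ R, x < N := by
    intro x hx
    have := (h2 x).1 (by simp [hx])
    have : x ≠ N := by rintro rfl; exact hNR hx
    omega
  have hlt : ∀ x ∈ M, ∀ y ∈ R, y < x := by
    intro x hx y hy
    have hne := hMR x hx y (by simp [hy])
    by_contra hcon
    refine h3 x y N (by omega) (hRN y hy) ?_
    exact (List.singleton_sublist.2 hx).append ((List.singleton_sublist.2 hy).cons_cons N)
  have hmem : ∀ x < N, x ∈ M ∨ x ∈ R := by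
    intro x hx
    have := (h2 x).2 (by omega)
    simp only [List.mem_append, List.mem_cons] at this
    rcases this with h | h | h
    · exact Or.inl h
    · omega
    · exact Or.inr h
  have hRmem := mem_iff_lt_length_of_lower hR (by
    intro x hx y hy
    rcases hmem y (hy.trans (hRN x hx)) with h | h
    · have := hlt y h x hx
      omega
    · exact h)
  set q := R.length with hq
  have hMge : ∀ x ∈ M, q ≤ x := by
    intro x hx
    by_contra hcon
    exact lt_irrefl x (hlt x hx x ((hRmem x).2 (by omega)))
  obtain ⟨L, rfl⟩ : ∃ L : List ℕ, L.map (· + q) = M := by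
    refine ⟨M.map (· - q), ?_⟩
    rw [List.map_map]
    conv_rhs => rw [← List.map_id M]
    refine List.map_congr_left fun x hx => ?_
    have := hMge x hx
    simp only [Function.comp_apply, id_eq]
    omega
  have hLlen : L.length + q = N := by
    simp only [List.length_append, List.length_map, List.length_cons, ← hq] at hlen
    omega
  rw [avoids132_append_cons hMN hRN (fun x hx y hy => (hlt x hx y hy).le),
    avoids132_map_add] at h3
  rw [shiftedAlt_append, ShiftedAlt, List.length_map] at h4
  obtain ⟨hA1, hA2, hA3⟩ := h4
  have hqr : q ≡ r [MOD k] := by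
    refine Nat.ModEq.add_right_cancel' L.length ?_
    rw [add_comm q, hLlen]
    exact hA2
  refine ⟨L.length, q, hLlen, hqr, L, ⟨?_, ?_, h3.1, ?_⟩, R, ⟨hR, hRmem, h3.2, ?_⟩, rfl⟩
  · exact hM.of_map _
  · intro x
    have hx : x ∈ L ↔ x + q ∈ L.map (· + q) := by simp
    rw [hx]
    constructor
    · intro h
      have := hMN _ h
      omega
    · intro h
      rcases hmem (x + q) (by omega) with h | h
      · exact h
      · rw [hRmem] at h
        omega
  · exact (shiftedAlt_map_add (by simpa using hqr)).1 hA1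
  · exact (shiftedAlt_congr (hA2.add_right 1)).2 hA3

theorem card_altWords_succ (k N r : ℕ) :
    Nat.card (altWords k (N + 1) r) = ∑ x ∈ antidiagonal N with x.2 ≡ r [MOD k],
      Nat.card (altWords k x.1 0) * Nat.card (altWords k x.2 (N + 1)) := by
  rw [← Finset.sum_coe_sort]
  simp_rw [← Nat.card_prod]
  rw [← Nat.card_sigma]
  symm
  have hx (x : {x ∈ antidiagonal N | x.2 ≡ r [MOD k]}) :
      x.1.1 + x.1.2 = N ∧ x.1.2 ≡ r [MOD k] := by
    have := x.2
    rwa [mem_filter, HasAntidiagonal.mem_antidiagonal] at this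
  let f : (Σ x : {x ∈ antidiagonal N | x.2 ≡ r [MOD k]},
      altWords k x.1.1 0 × altWords k x.1.2 (N + 1)) → altWords k (N + 1) r :=
    fun y => ⟨(y.2.1 : List ℕ).map (· + y.1.1.2) ++ N :: (y.2.2 : List ℕ), by
      obtain ⟨⟨⟨p, q⟩, hpq⟩, L, R⟩ := y
      obtain ⟨hN, hqr⟩ := hx ⟨(p, q), hpq⟩
      simp only at hN hqr L R
      subst hN
      exact append_cons_mem_altWords hqr L.2 R.2⟩
  refine Nat.card_eq_of_bijective f ⟨?_, ?_⟩
  · rintro ⟨⟨⟨p, q⟩, hpq⟩, ⟨L, hL⟩, ⟨R, hR⟩⟩ ⟨⟨⟨p', q'⟩, hpq'⟩, ⟨L', hL'⟩, ⟨R', hR'⟩⟩ h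
    have e : L.map (· + q) ++ N :: R = L'.map (· + q') ++ N :: R' := congrArg Subtype.val h
    have hN := (hx ⟨(p, q), hpq⟩).1
    have hN' := (hx ⟨(p', q'), hpq'⟩).1
    simp only at hN hN'
    have key : ∀ {p q : ℕ} {L : List ℕ}, p + q = N → L ∈ altWords k p 0 →
        N ∉ L.map (· + q) := by
      intro p q L hN hL hmem
      obtain ⟨x, hx, hxN⟩ := List.mem_map.1 hmem
      rw [hL.2.1] at hx
      omega
    have hNR : N ∉ R' := by
      intro hmem
      have := (hR'.2.1 N).1 hmem
      simp only at this
      omega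
    obtain ⟨e1, -, rfl⟩ := (List.append_cons_inj_of_notMem (key hN' hL') hNR).1 e.symm
    obtain rfl : q = q' := (length_of_mem_altWords hR).symm.trans (length_of_mem_altWords hR')
    obtain rfl : p = p' := by omega
    obtain rfl : L = L' := List.map_injective_iff.2 (add_left_injective q) e1.symm
    rfl
  · rintro ⟨l, hl⟩
    obtain ⟨p, q, hpq, hqr, L, hL, R, hR, e⟩ := exists_append_cons_of_mem_altWords hl
    exact ⟨⟨⟨(p, q), by simp [hpq, hqr]⟩, ⟨L, hL⟩, ⟨R, hR⟩⟩, Subtype.ext e⟩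

theorem sum_antidiagonal_filter_modEq {α : Type*} [AddCommMonoid α] {k c r : ℕ} (M : ℕ)
    (hc : c < k) (hr : r ≤ c) (g : ℕ → ℕ → α) :
    ∑ x ∈ antidiagonal (k * M + c) with x.2 ≡ r [MOD k], g x.1 x.2 =
      ∑ x ∈ antidiagonal M, g (k * x.1 + (c - r)) (k * x.2 + r) := by
  symm
  refine Finset.sum_bij (fun x _ => (k * x.1 + (c - r), k * x.2 + r)) ?_ ?_ ?_ (fun _ _ => rfl)
  · rintro ⟨a, b⟩ h
    simp only [HasAntidiagonal.mem_antidiagonal, mem_filter] at h ⊢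
    subst h
    refine ⟨?_, by simp [Nat.ModEq]⟩
    rw [mul_add]
    omega
  · rintro ⟨a, b⟩ - ⟨a', b'⟩ - h
    have hk : 0 < k := by omega
    simp only [Prod.mk.injEq, Nat.add_right_cancel_iff] at h
    exact Prod.ext (Nat.eq_of_mul_eq_mul_left hk h.1) (Nat.eq_of_mul_eq_mul_left hk h.2)
  · rintro ⟨p, q⟩ h
    simp only [HasAntidiagonal.mem_antidiagonal, mem_filter] at h
    obtain ⟨h, hq⟩ := h
    have hqr : q % k = r := Eq.trans hq (Nat.mod_eq_of_lt (by omega))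
    have hq' : k * (q / k) + r = q := by rw [← hqr]; exact Nat.div_add_mod q k
    have hle : q / k ≤ M := by
      by_contra hcon
      have : k * (M + 1) ≤ k * (q / k) := Nat.mul_le_mul_left k (by omega)
      rw [mul_add] at this
      omega
    refine ⟨(M - q / k, q / k), HasAntidiagonal.mem_antidiagonal.2 (Nat.sub_add_cancel hle),
      Prod.ext ?_ hq'⟩
    have : k * M = k * (M - q / k) + k * (q / k) := by rw [← mul_add, Nat.sub_add_cancel hle]
    simp only
    omega

theorem card_altWords_eq {k : ℕ} (hk : 0 < k) (N : ℕ) :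
    (∀ m j, j < k → N = k * m + j → Nat.card (altWords k N 0) = fussCatalan k m (j + 1)) ∧
      (∀ t, N = k * t → ∀ r, Nat.card (altWords k N r) = fussCatalan k t 1) := by
  induction N using Nat.strong_induction_on with
  | _ N ih =>
  obtain _ | N := N
  · constructor
    · intro m j _ h
      obtain ⟨h1, rfl⟩ := Nat.add_eq_zero_iff.1 h.symm
      obtain rfl := (Nat.mul_eq_zero.1 h1).resolve_left hk.ne'
      simp [altWords_zero, fussCatalan]
    · intro t h r
      obtain rfl := (Nat.mul_eq_zero.1 h.symm).resolve_left hk.ne'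
      simp [altWords_zero, fussCatalan]
  have main : ∀ M c, c < k → N = k * M + c →
      Nat.card (altWords k (N + 1) 0) = fussCatalan k M (c + 2) := by
    intro M c hc hN
    subst hN
    rw [card_altWords_succ, sum_antidiagonal_filter_modEq M hc (Nat.zero_le c)
      (fun p q => Nat.card (altWords k p 0) * Nat.card (altWords k q (k * M + c + 1))),
      show c + 2 = (c + 1) + 1 from rfl, ← sum_antidiagonal_fussCatalan_mul]
    refine Finset.sum_congr rfl ?_
    rintro ⟨a, b⟩ hab
    rw [HasAntidiagonal.mem_antidiagonal] at hab
    simp only at hab ⊢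
    subst hab
    rw [mul_add] at ih
    rw [(ih (k * a + (c - 0)) (by omega)).1 a c hc rfl, (ih (k * b + 0) (by omega)).2 b rfl]
  constructor
  · intro m j hj h
    obtain _ | j := j
    · obtain _ | m := m
      · omega
      rw [main m (k - 1) (by omega) (by rw [mul_add] at h; omega), fussCatalan, fussCatalan, zero_add]
      congr 1
      omega
    · exact main m j (by omega) (by omega)
  · intro t h r
    obtain _ | t := t
    · omega
    have hr : r % k < k := Nat.mod_lt r hk
    have hN : N = k * t + (k - 1) := by rw [mul_add] at h; omega
    have hN0 : N + 1 ≡ 0 [MOD k] := by rw [h]; simp [Nat.ModEq]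
    rw [altWords_congr (Nat.mod_modEq r k).symm, card_altWords_succ]
    simp_rw [altWords_congr hN0]
    clear h hN0 main
    subst hN
    rw [sum_antidiagonal_filter_modEq t (by omega) (by omega)
      (fun p q => Nat.card (altWords k p 0) * Nat.card (altWords k q 0)), fussCatalan,
      fussCatalan, zero_add, show 0 + (k + 1) = (k - 1 - r % k + 1) + (r % k + 1) by omega,
      ← sum_antidiagonal_fussCatalan_mul]
    refine Finset.sum_congr rfl ?_
    rintro ⟨a, b⟩ hab
    rw [HasAntidiagonal.mem_antidiagonal] at hab
    simp only at hab ⊢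
    subst hab
    rw [mul_add] at ih
    rw [(ih (k * a + (k - 1 - r % k)) (by omega)).1 a _ (by omega) rfl,
      (ih (k * b + r % k) (by omega)).1 b _ hr rfl]

/-- The word of values of a permutation. -/
def permWord {n : ℕ} (π : Equiv.Perm (Fin n)) : List ℕ :=
  List.ofFn fun i => (π i : ℕ)

theorem avoids132_permWord {n : ℕ} (π : Equiv.Perm (Fin n)) :
    Avoids132 (permWord π) ↔ ¬ Pattern3 pat132 π := by
  have hlen : (permWord π).length = n := by simp [permWord]
  constructor
  · rintro h ⟨f, hf, hπ⟩
    refine h (π (f 0)) (π (f 2)) (π (f 1)) ((hπ 0 2).1 (by decide)) ((hπ 2 1).1 (by decide)) ?_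
    have hs : List.ofFn (fun i => ((π (f i) : Fin n) : ℕ)) = [(π (f 0) : ℕ), π (f 1), π (f 2)] := by
      simp [List.ofFn_succ]
    rw [← hs, List.sublist_iff_exists_fin_orderEmbedding_get_eq]
    refine ⟨OrderEmbedding.ofStrictMono
      (fun i => Fin.cast hlen.symm (f (Fin.cast (by simp) i))) fun i j hij => ?_, fun i => ?_⟩
    · exact hf (Fin.lt_def.2 hij)
    · simp only [permWord, List.get_eq_getElem, List.getElem_ofFn]
      rfl
  · intro h a b c hab hbc hs
    obtain ⟨f, hf⟩ := List.sublist_iff_exists_fin_orderEmbedding_get_eq.1 hs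
    refine h ⟨fun i => Fin.cast hlen (f i), fun i j hij => f.strictMono hij, ?_⟩
    have hval : ∀ i : Fin 3, (π (Fin.cast hlen (f i)) : ℕ) = [a, c, b].get i := by
      intro i
      rw [hf i]
      simp [permWord]
      rfl
    intro i j
    rw [Fin.lt_def (a := π _), hval, hval]
    fin_cases i <;> fin_cases j <;> simp [pat132, Equiv.swap_apply_def] <;> omega

theorem permWord_mem_altWords {n k : ℕ} (π : Equiv.Perm (Fin n)) :
    permWord π ∈ altWords k n 0 ↔ ModKAlt k π ∧ ¬ Pattern3 pat132 π := by
  have h1 : (permWord π).Nodup :=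
    List.nodup_ofFn.2 (Fin.val_injective.comp π.injective)
  have h2 : ∀ x, x ∈ permWord π ↔ x < n := by
    intro x
    rw [permWord, List.mem_ofFn]
    constructor
    · rintro ⟨i, rfl⟩
      exact (π i).2
    · intro hx
      exact ⟨π.symm ⟨x, hx⟩, by simp⟩
  have h4 : ShiftedAlt k 0 (permWord π) ↔ ModKAlt k π := by
    rw [shiftedAlt_iff_getElem]
    simp only [permWord, List.getElem_ofFn, List.length_ofFn, zero_add]
    exact ⟨fun h i => h i i.2, fun h i hi => h ⟨i, hi⟩⟩
  rw [← avoids132_permWord, ← h4]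
  simp only [altWords, Set.mem_ofPred_eq, h1, true_and]
  tauto

theorem mpPat_pat132 (k n : ℕ) : mpPat k pat132 n = Nat.card (altWords k n 0) := by
  refine Nat.card_eq_of_bijective
    (fun π => ⟨permWord π.1, (permWord_mem_altWords π.1).2 π.2⟩) ⟨?_, ?_⟩
  · rintro ⟨π, hπ⟩ ⟨τ, hτ⟩ h
    have h' := List.ofFn_injective (congrArg Subtype.val h)
    exact Subtype.ext (Equiv.ext fun i => Fin.ext (congrFun h' i))
  · rintro ⟨l, hl⟩
    have hlen := length_of_mem_altWords hl
    subst hlen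
    have hlt : ∀ i : Fin l.length, l.get i < l.length := fun i => (hl.2.1 _).1 (List.get_mem _ _)
    have hinj : Function.Injective fun i : Fin l.length => (⟨l.get i, hlt i⟩ : Fin l.length) := by
      intro i j hij
      exact List.nodup_iff_injective_get.1 hl.1 (congrArg Fin.val hij)
    set π := Equiv.ofBijective _ (Finite.injective_iff_bijective.1 hinj)
    have hπ : permWord π = l := List.ofFn_get l
    refine ⟨⟨π, (permWord_mem_altWords π).1 (by rwa [hπ])⟩, Subtype.ext hπ⟩

theorem revflip_revflip {n : ℕ} (π : Equiv.Perm (Fin n)) : revflip (revflip π) = π := by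
  ext i
  simp [revflip]

theorem ModKAlt.revflip {n k : ℕ} {π : Equiv.Perm (Fin n)} (h : ModKAlt k π) :
    ModKAlt k (revflip π) := by
  intro i
  have hi := h i.rev
  simp only [_root_.revflip, Equiv.trans_apply, Fin.revPerm_apply]
  set y := π i.rev
  have e1 : (y.rev : ℕ) + y = n - 1 := by rw [Fin.val_rev]; omega
  have e2 : (i : ℕ) + i.rev = n - 1 := by rw [Fin.val_rev]; omega
  exact Nat.ModEq.add_right_cancel hi (by rw [e1, e2])

theorem Pattern3.revflip {n : ℕ} {σ τ : Equiv.Perm (Fin 3)}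
    (hστ : ∀ a b : Fin 3, τ a < τ b ↔ σ b.rev < σ a.rev) {π : Equiv.Perm (Fin n)}
    (h : Pattern3 σ π) : Pattern3 τ (revflip π) := by
  obtain ⟨f, hf, hπ⟩ := h
  refine ⟨fun a => (f a.rev).rev, fun a b hab => ?_, fun a b => ?_⟩
  · exact Fin.rev_lt_rev.2 (hf (Fin.rev_lt_rev.2 hab))
  · simp [_root_.revflip, hστ, hπ]

theorem mpPat_pat213 (k n : ℕ) : mpPat k pat213 n = mpPat k pat132 n := by
  have h1 : ∀ a b : Fin 3, pat132 a < pat132 b ↔ pat213 b.rev < pat213 a.rev := by decide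
  have h2 : ∀ a b : Fin 3, pat213 a < pat213 b ↔ pat132 b.rev < pat132 a.rev := by decide
  refine Nat.card_congr ⟨fun π => ⟨revflip π.1, π.2.1.revflip, fun h => π.2.2 ?_⟩,
    fun π => ⟨revflip π.1, π.2.1.revflip, fun h => π.2.2 ?_⟩,
    fun π => Subtype.ext (revflip_revflip π.1), fun π => Subtype.ext (revflip_revflip π.1)⟩
  · simpa only [revflip_revflip] using h.revflip h2
  · simpa only [revflip_revflip] using h.revflip h1

theorem mpPat_eq_fussCatalan {k : ℕ} {σ : Equiv.Perm (Fin 3)} (hσ : σ = pat132 ∨ σ = pat213)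
    {m j : ℕ} (hj : j < k) : mpPat k σ (k * m + j) = fussCatalan k m (j + 1) := by
  have h := (card_altWords_eq (by omega : 0 < k) (k * m + j)).1 m j hj rfl
  rcases hσ with rfl | rfl
  · rw [mpPat_pat132, h]
  · rw [mpPat_pat213, mpPat_pat132, h]

theorem mp_fuss_catalan (k : ℕ) (hk : 2 ≤ k) (σ : Equiv.Perm (Fin 3))
    (hσ : σ = pat132 ∨ σ = pat213) (n m j : ℕ) (hn : 1 ≤ n)
    (hnm : n = k * m + j) (hj : j < k) :
    (mpPat k σ n : ℚ) =
      (j + 1) / (k * m + j + 1) * (((k + 1) * m + j).choose (k * m + j)) ∧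
    (∀ m' : ℕ, (mpPat k σ (k * m') : ℚ) = 1 / (k * m' + 1) * (((k + 1) * m').choose m')) := by
  refine ⟨?_, fun m' => ?_⟩
  · rw [hnm, mpPat_eq_fussCatalan hσ hj, fussCatalan_succ_eq]
  · have h := mpPat_eq_fussCatalan (m := m') hσ (by omega : 0 < k)
    have h' := fussCatalan_succ_eq k m' 0
    have hs : ((k + 1) * m').choose (k * m') = ((k + 1) * m').choose m' :=
      Nat.choose_symm_of_eq_add (by ring)
    simp only [add_zero, Nat.cast_zero, zero_add] at h h'
    rw [h, h', hs]
end

section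
/- Let k ≥ 3, n ≥ 1, and r ∈ [k]. Then mp_{312}(n,k,r) equals 1 if r = 1 (in which case MP_{312}(n,k,1) consists of only the identity permutation); it equals 2^{n/k − 1} if r = 2 and k divides n; and it equals 0 otherwise. -/
open Finset

/-- `f` restricts to a permutation of `{0, …, m - 1}` that avoids `312` and satisfies
`f i ≡ i + t (mod k)`. -/
structure ShiftAvoid (k m t : ℕ) (f : ℕ → ℕ) : Prop where
  lt : ∀ i < m, f i < m
  inj : ∀ i < m, ∀ i' < m, f i = f i' → i = i'
  mod : ∀ i < m, f i % k = (i + t) % k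
  avoid : ∀ a b c, a < b → b < c → c < m → ¬ (f b < f c ∧ f c < f a)

namespace ShiftAvoid

variable {k m n t : ℕ} {f g : ℕ → ℕ}

lemma exists_eq_zero (h : ShiftAvoid k (n + 1) t f) : ∃ j ≤ n, f j = 0 := by
  have hsurj := Finset.surj_on_of_inj_on_of_card_le (s := range (n + 1)) (t := range (n + 1))
    (fun i _ => f i) (fun i hi => by simpa using h.lt i (by simpa using hi))
    (fun a b ha hb hab => h.inj a (by simpa using ha) b (by simpa using hb) hab) le_rfl
    0 (by simp)
  obtain ⟨j, hj, hj0⟩ := hsurj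
  exact ⟨j, by simp at hj; omega, hj0.symm⟩

/-- A `312`-avoiding permutation splits around its minimum, the values on the left of the minimum
being smaller than those on the right. -/
lemma decomp (h : ShiftAvoid k (n + 1) t f) {t' : ℕ} (ht : (t' + 1) % k = t % k) :
    ∃ j ≤ n, f j = 0 ∧ (j + t) % k = 0 ∧ (∀ i < j, 1 ≤ f i) ∧ (∀ i, j < i → i ≤ n → j < f i) ∧
      ShiftAvoid k j t' (fun i => f i - 1) ∧
      ShiftAvoid k (n - j) t (fun i => f (j + 1 + i) - (j + 1)) := by
  obtain ⟨j, hj, hj0⟩ := h.exists_eq_zero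
  have hpos : ∀ i ≤ n, i ≠ j → 1 ≤ f i := by
    intro i hi hij
    by_contra hc
    exact hij (h.inj i (by omega) j (by omega) (by omega))
  have hlr : ∀ i < j, ∀ i', j < i' → i' ≤ n → f i < f i' := by
    intro i hi i' hi' hn
    have h1 := h.avoid i j i' hi hi' (by omega)
    have h2 := hpos i' hn (by omega)
    have h3 : f i ≠ f i' := fun he => by
      have := h.inj i (by omega) i' (by omega) he
      omega
    omega
  have hleft : ∀ i < j, f i ≤ j := by
    intro i hi
    have hc := Finset.card_le_card_of_injOn (s := Ioc j n) (t := Ioc (f i) n) f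
      (fun x hx => by
        simp only [coe_Ioc, Set.mem_Ioc] at hx ⊢
        have := h.lt x (by omega)
        exact ⟨hlr i hi x hx.1 hx.2, by omega⟩)
      (fun x hx y hy hxy => by
        simp only [coe_Ioc, Set.mem_Ioc] at hx hy
        exact h.inj x (by omega) y (by omega) hxy)
    have := h.lt i (by omega)
    simp at hc
    omega
  have hright : ∀ i, j < i → i ≤ n → j < f i := by
    intro i hi hn
    have hc := Finset.card_le_card_of_injOn (s := range (j + 1)) (t := range (f i)) f
      (fun x hx => by
        simp only [coe_range, Set.mem_Iio] at hx ⊢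
        rcases Nat.lt_succ_iff_lt_or_eq.mp hx with hx | rfl
        · exact hlr x hx i hi hn
        · have := hpos i hn (by omega)
          omega)
      (fun x hx y hy hxy => by
        simp only [coe_range, Set.mem_Iio] at hx hy
        exact h.inj x (by omega) y (by omega) hxy)
    simp at hc
    omega
  refine ⟨j, hj, hj0, ?_, fun i hi => hpos i (by omega) (by omega), hright, ?_, ?_⟩
  · rw [← h.mod j (by omega), hj0, Nat.zero_mod]
  · have hp : ∀ i < j, 1 ≤ f i := fun i hi => hpos i (by omega) (by omega)
    refine ⟨fun i hi => ?_, fun i hi i' hi' he => ?_, fun i hi => ?_, fun a b c hab hbc hc => ?_⟩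
    · have := hp i hi
      have := hleft i hi
      omega
    · have := hp i hi
      have := hp i' hi'
      exact h.inj i (by omega) i' (by omega) (by omega)
    · have h1 : f i - 1 + 1 ≡ i + t' + 1 [MOD k] := by
        rw [Nat.sub_add_cancel (hp i hi)]
        exact (show f i ≡ i + t [MOD k] from h.mod i (by omega)).trans
          (Nat.ModEq.add_left i (show t' + 1 ≡ t [MOD k] from ht).symm)
      exact Nat.ModEq.add_right_cancel' 1 h1
    · have := h.avoid a b c hab hbc (by omega)
      have := hp b (by omega)
      omega
  · have hp : ∀ i < n - j, j + 1 ≤ f (j + 1 + i) :=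
      fun i hi => hright _ (by omega) (by omega)
    refine ⟨fun i hi => ?_, fun i hi i' hi' he => ?_, fun i hi => ?_, fun a b c hab hbc hc => ?_⟩
    · have := hp i hi
      have := h.lt (j + 1 + i) (by omega)
      omega
    · have := hp i hi
      have := hp i' hi'
      have := h.inj (j + 1 + i) (by omega) (j + 1 + i') (by omega) (by omega)
      omega
    · have h1 : f (j + 1 + i) - (j + 1) + (j + 1) ≡ i + t + (j + 1) [MOD k] := by
        rw [Nat.sub_add_cancel (hp i hi)]
        have := h.mod (j + 1 + i) (by omega)
        rwa [show j + 1 + i + t = i + t + (j + 1) by ring] at this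
      exact Nat.ModEq.add_right_cancel' (j + 1) h1
    · have := h.avoid (j + 1 + a) (j + 1 + b) (j + 1 + c) (by omega) (by omega) (by omega)
      have := hp b (by omega)
      have := hp c (by omega)
      omega

lemma dvd_of_pos (h : ShiftAvoid k m t f) (ht : 1 ≤ t) (htk : t < k) : k ∣ m := by
  induction m using Nat.strong_induction_on generalizing t f with
  | _ m ih =>
    obtain _ | n := m
    · exact dvd_zero k
    obtain ⟨j, hj, -, hmod, -, -, hL, hR⟩ := h.decomp (t' := t - 1) (by congr 1; omega)
    have hdvd := Nat.dvd_of_mod_eq_zero hmod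
    obtain rfl | ht2 := ht.eq_or_lt
    · have := ih (n - j) (by omega) hR le_rfl htk
      have := dvd_add this hdvd
      rwa [show n - j + (j + 1) = n + 1 by omega] at this
    · have := ih j (by omega) hL (by omega) (by omega)
      have := Nat.le_of_dvd (by omega) ((Nat.dvd_add_right this).mp hdvd)
      omega

lemma eq_zero_of_two_le (h : ShiftAvoid k m t f) (ht : 2 ≤ t) (htk : t < k) : m = 0 := by
  obtain _ | n := m
  · rfl
  obtain ⟨j, hj, -, hmod, -, -, hL, hR⟩ := h.decomp (t' := t - 1) (by congr 1; omega)
  have := hL.dvd_of_pos (by omega) (by omega)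
  have := Nat.le_of_dvd (by omega)
    ((Nat.dvd_add_right this).mp (Nat.dvd_of_mod_eq_zero hmod))
  omega

lemma eq_self (hk : 3 ≤ k) (h : ShiftAvoid k m 0 f) : ∀ i < m, f i = i := by
  induction m generalizing f with
  | zero => simp
  | succ n ih =>
    obtain ⟨j, hj, hj0, -, -, hr, hL, hR⟩ := h.decomp (t' := k - 1)
      (by rw [Nat.sub_add_cancel (by omega)]; simp)
    obtain rfl := hL.eq_zero_of_two_le (by omega) (by omega)
    rintro (_ | i) hi
    · exact hj0
    · have h1 := ih hR i (by omega)
      have h2 := hr (i + 1) (by omega) (by omega)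
      simp only [zero_add, Nat.add_comm 1 i] at h1
      omega

lemma eq_of_iff (hk : 3 ≤ k) (hf : ShiftAvoid k m 1 f) (hg : ShiftAvoid k m 1 g)
    (hfg : ∀ i, (i + 1) % k = 0 → i + 1 < m → (f i = i + 1 ↔ g i = i + 1)) :
    ∀ i < m, f i = g i := by
  induction m using Nat.strong_induction_on generalizing f g with
  | _ m ih =>
    obtain _ | n := m
    · simp
    obtain ⟨j, hj, hj0, hjm, hjp, hjr, hjL, hjR⟩ := hf.decomp (t' := 0) (by simp)
    obtain ⟨j', hj', hj0', hjm', hjp', hjr', hjL', hjR'⟩ := hg.decomp (t' := 0) (by simp)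
    have hL : ∀ i < j, f i = i + 1 := fun i hi => by
      have := hjL.eq_self hk i hi
      have := hjp i hi
      omega
    have hL' : ∀ i < j', g i = i + 1 := fun i hi => by
      have := hjL'.eq_self hk i hi
      have := hjp' i hi
      omega
    obtain rfl : j = j' := by
      rcases lt_trichotomy j j' with hlt | heq | hlt
      · have := (hfg j hjm (by omega)).2 (hL' j hlt)
        omega
      · exact heq
      · have := (hfg j' hjm' (by omega)).1 (hL j' hlt)
        omega
    have key := ih (n - j) (by omega) hjR hjR' fun i hi hin => by
      have hmod : (j + 1 + i + 1) % k = 0 := by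
        rw [show j + 1 + i + 1 = (j + 1) + (i + 1) by ring, Nat.add_mod, hjm, hi]
        simp
      have h1 := hfg (j + 1 + i) hmod (by omega)
      have h2 := hjr (j + 1 + i) (by omega) (by omega)
      have h3 := hjr' (j + 1 + i) (by omega) (by omega)
      constructor
      · intro h
        have := h1.1 (by omega)
        omega
      · intro h
        have := h1.2 (by omega)
        omega
    intro i hi
    rcases lt_trichotomy i j with hlt | heq | hlt
    · rw [hL i hlt, hL' i hlt]
    · rw [heq, hj0, hj0']
    · have h1 := key (i - (j + 1)) (by omega)
      have h2 := hjr i hlt (by omega)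
      have h3 := hjr' i hlt (by omega)
      simp only [show j + 1 + (i - (j + 1)) = i by omega] at h1
      omega

end ShiftAvoid

open Classical in
/-- The first position of the block containing `i`, where blocks end at the elements of `D`. -/
noncomputable def blockStart (D : Set ℕ) : ℕ → ℕ
  | 0 => 0
  | i + 1 => if i ∈ D then i + 1 else blockStart D i

open Classical in
/-- The map rotating each block by one step, where blocks end at the elements of `D`. -/
noncomputable def blockRotate (D : Set ℕ) (i : ℕ) : ℕ :=
  if i ∈ D then blockStart D i else i + 1

section Block

variable {D : Set ℕ}

lemma blockStart_le (i : ℕ) : blockStart D i ≤ i := by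
  induction i with
  | zero => simp [blockStart]
  | succ i ih =>
    rw [blockStart]
    split_ifs <;> omega

lemma lt_blockStart {i i' : ℕ} (hi : i ∈ D) (h : i < i') : i < blockStart D i' := by
  induction i' with
  | zero => omega
  | succ i' ih =>
    rw [blockStart]
    split_ifs with hD
    · omega
    · rcases Nat.lt_succ_iff_lt_or_eq.mp h with h | rfl
      · exact ih h
      · exact absurd hi hD

lemma blockStart_spec (i : ℕ) : blockStart D i = 0 ∨ ∃ d ∈ D, blockStart D i = d + 1 := by
  induction i with
  | zero => simp [blockStart]
  | succ i ih =>
    rw [blockStart]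
    split_ifs with hD
    · exact Or.inr ⟨i, hD, rfl⟩
    · exact ih

lemma blockRotate_of_mem {i : ℕ} (h : i ∈ D) : blockRotate D i = blockStart D i := if_pos h

lemma blockRotate_of_notMem {i : ℕ} (h : i ∉ D) : blockRotate D i = i + 1 := if_neg h

lemma lt_blockRotate {i i' : ℕ} (hi : i ∈ D) (h : i < i') : i < blockRotate D i' := by
  by_cases h' : i' ∈ D
  · rw [blockRotate_of_mem h']
    exact lt_blockStart hi h
  · rw [blockRotate_of_notMem h']
    omega

lemma blockRotate_le_of_mem {i : ℕ} (hi : i ∈ D) : blockRotate D i ≤ i :=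
  blockRotate_of_mem hi ▸ blockStart_le i

lemma blockRotate_ne_of_lt {i i' : ℕ} (h : i < i') : blockRotate D i ≠ blockRotate D i' := by
  by_cases hi : i ∈ D
  · have := blockRotate_le_of_mem hi
    have := lt_blockRotate hi h
    omega
  · rw [blockRotate_of_notMem hi]
    by_cases hi' : i' ∈ D
    · rw [blockRotate_of_mem hi']
      rcases blockStart_spec (D := D) i' with h0 | ⟨d, hd, h0⟩
      · omega
      · rw [h0]
        intro he
        obtain rfl : i = d := by omega
        exact hi hd
    · rw [blockRotate_of_notMem hi']
      omega

lemma blockRotate_shiftAvoid {k m : ℕ} (hD : ∀ d ∈ D, (d + 1) % k = 0) (hm : m ∈ D) :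
    ShiftAvoid k (m + 1) 1 (blockRotate D) where
  lt i hi := by
    by_cases h : i ∈ D
    · have := blockRotate_le_of_mem h
      omega
    · rw [blockRotate_of_notMem h]
      have : i ≠ m := fun he => h (he ▸ hm)
      omega
  inj i hi i' hi' he := by
    rcases lt_trichotomy i i' with h | h | h
    · exact absurd he (blockRotate_ne_of_lt h)
    · exact h
    · exact absurd he.symm (blockRotate_ne_of_lt h)
  mod i hi := by
    by_cases h : i ∈ D
    · rw [blockRotate_of_mem h, hD i h]
      rcases blockStart_spec (D := D) i with h0 | ⟨d, hd, h0⟩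
      · simp [h0]
      · rw [h0, hD d hd]
    · rw [blockRotate_of_notMem h]
  avoid a b c hab hbc hc := by
    rintro ⟨h1, h2⟩
    by_cases ha : a ∈ D
    · have := blockRotate_le_of_mem ha
      have := lt_blockRotate ha (hab.trans hbc)
      omega
    rw [blockRotate_of_notMem ha] at h2
    by_cases hb : b ∈ D
    · have := lt_blockRotate hb hbc
      omega
    · rw [blockRotate_of_notMem hb] at h1
      omega

end Block

/-- The values of a permutation of `Fin n`, extended by zero to all natural numbers. -/
def natVal {n : ℕ} (π : Equiv.Perm (Fin n)) (i : ℕ) : ℕ := if h : i < n then π ⟨i, h⟩ else 0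

lemma natVal_of_lt {n : ℕ} (π : Equiv.Perm (Fin n)) {i : ℕ} (h : i < n) :
    natVal π i = π ⟨i, h⟩ := dif_pos h

lemma natVal_ext {n : ℕ} {π ρ : Equiv.Perm (Fin n)} (h : ∀ i < n, natVal π i = natVal ρ i) :
    π = ρ := by
  ext i
  simpa [natVal_of_lt _ i.2] using h i i.2

lemma pattern3_pat312_iff {n : ℕ} (π : Equiv.Perm (Fin n)) :
    Pattern3 pat312 π ↔ ∃ a b c : Fin n, a < b ∧ b < c ∧ π b < π c ∧ π c < π a := by
  have h0 : pat312 0 = 2 := by decide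
  have h1 : pat312 1 = 0 := by decide
  have h2 : pat312 2 = 1 := by decide
  constructor
  · rintro ⟨f, hf, h⟩
    refine ⟨f 0, f 1, f 2, hf (by decide), hf (by decide), (h 1 2).1 ?_, (h 2 0).1 ?_⟩
    · rw [h1, h2]; decide
    · rw [h0, h2]; decide
  · rintro ⟨a, b, c, hab, hbc, hbc', hca'⟩
    refine ⟨![a, b, c], ?_, ?_⟩
    · intro i j hij
      fin_cases i <;> fin_cases j <;> simp at hij ⊢ <;> first | assumption | exact hab.trans hbc
    · have hba' := hbc'.trans hca'
      intro i j
      fin_cases i <;> fin_cases j <;>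
        simp [h0, h1, h2, hbc', hca', hba', hbc'.le, hca'.le, hba'.le]

lemma shiftAvoid_natVal_iff {n k r : ℕ} (hr : 1 ≤ r) (π : Equiv.Perm (Fin n)) :
    ShiftAvoid k n (r - 1) (natVal π) ↔ ModKAltR k r π ∧ ¬ Pattern3 pat312 π := by
  have hmod : ∀ i : Fin n, (π i : ℕ) % k = (i + (r - 1)) % k ↔
      ((π i : ℕ) + 1) % k = (r + i) % k := fun i => by
    rw [show r + (i : ℕ) = i + (r - 1) + 1 by omega]
    exact ⟨fun h => Nat.ModEq.add_right 1 h, fun h => Nat.ModEq.add_right_cancel' 1 h⟩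
  rw [pattern3_pat312_iff]
  constructor
  · intro h
    refine ⟨fun i => (hmod i).1 ?_, ?_⟩
    · simpa [natVal_of_lt _ i.2] using h.mod i i.2
    · rintro ⟨a, b, c, hab, hbc, h1, h2⟩
      refine h.avoid a b c hab hbc c.2 ?_
      simpa [natVal_of_lt _ a.2, natVal_of_lt _ b.2, natVal_of_lt _ c.2] using ⟨h1, h2⟩
  · rintro ⟨hm, hp⟩
    refine ⟨fun i hi => ?_, fun i hi i' hi' he => ?_, fun i hi => ?_, fun a b c hab hbc hc => ?_⟩
    · rw [natVal_of_lt _ hi]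
      exact (π ⟨i, hi⟩).2
    · rw [natVal_of_lt _ hi, natVal_of_lt _ hi'] at he
      simpa using π.injective (Fin.ext he)
    · rw [natVal_of_lt _ hi]
      exact (hmod ⟨i, hi⟩).2 (hm ⟨i, hi⟩)
    · rw [natVal_of_lt π (hab.trans (hbc.trans hc)), natVal_of_lt π (hbc.trans hc),
        natVal_of_lt π hc]
      rintro ⟨h1, h2⟩
      exact hp ⟨_, _, _, hab, hbc, h1, h2⟩

lemma ShiftAvoid.exists_natVal {k n t : ℕ} {f : ℕ → ℕ} (h : ShiftAvoid k n t f) :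
    ∃ π : Equiv.Perm (Fin n), ∀ i < n, natVal π i = f i := by
  have hinj : Function.Injective (fun i : Fin n => (⟨f i, h.lt i i.2⟩ : Fin n)) :=
    fun i j hij => Fin.ext (h.inj i i.2 j j.2 (by simpa using hij))
  refine ⟨Equiv.ofBijective _ (Finite.injective_iff_bijective.mp hinj), fun i hi => ?_⟩
  rw [natVal_of_lt _ hi]
  rfl

lemma ShiftAvoid.congr {k n t : ℕ} {f g : ℕ → ℕ} (h : ShiftAvoid k n t f)
    (hfg : ∀ i < n, g i = f i) : ShiftAvoid k n t g where
  lt i hi := hfg i hi ▸ h.lt i hi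
  inj i hi i' hi' he := h.inj i hi i' hi' (by rwa [hfg i hi, hfg i' hi'] at he)
  mod i hi := hfg i hi ▸ h.mod i hi
  avoid a b c hab hbc hc := by
    rw [hfg a (by omega), hfg b (by omega), hfg c hc]
    exact h.avoid a b c hab hbc hc

lemma shiftAvoid_id (k n : ℕ) : ShiftAvoid k n 0 (fun i => i) :=
  ⟨fun _ h => h, fun _ _ _ _ h => h, fun _ _ => rfl, fun _ _ _ _ _ _ => by omega⟩

/-- A permutation in the case of shift one is determined by the set of multiples `k * (d + 1)` at
which a new block starts, and this set is arbitrary. -/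
lemma card_shiftAvoid_one {k : ℕ} (hk : 3 ≤ k) (M : ℕ) :
    Nat.card {π : Equiv.Perm (Fin (k * (M + 1))) // ShiftAvoid k (k * (M + 1)) 1 (natVal π)} =
      2 ^ M := by
  let F : {π : Equiv.Perm (Fin (k * (M + 1))) // ShiftAvoid k (k * (M + 1)) 1 (natVal π)} →
      Set (Fin M) := fun π => {d | natVal π.1 (k * (d + 1) - 1) ≠ k * (d + 1)}
  have hkpos : ∀ d, 0 < k * (d + 1) := fun d => by positivity
  have hF : Function.Bijective F := by
    constructor
    · intro π ρ hπρ
      refine Subtype.ext (natVal_ext (π.2.eq_of_iff hk ρ.2 fun i hi him => ?_))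
      obtain ⟨e, he⟩ := Nat.dvd_of_mod_eq_zero hi
      obtain _ | d := e
      · omega
      have hd : d < M := by
        rw [he] at him
        have := Nat.lt_of_mul_lt_mul_left him
        omega
      have := Set.ext_iff.mp hπρ ⟨d, hd⟩
      simp only [F, Set.mem_ofPred_eq, ← he, Nat.add_sub_cancel] at this
      exact not_iff_not.mp this
    · intro S
      let D : Set ℕ := {i | i = k * (M + 1) - 1 ∨ ∃ d ∈ S, i = k * ((d : ℕ) + 1) - 1}
      have hD : ∀ i ∈ D, (i + 1) % k = 0 := by
        rintro i (rfl | ⟨d, -, rfl⟩) <;> rw [Nat.sub_add_cancel (hkpos _)] <;> simp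
      have hG : ShiftAvoid k (k * (M + 1)) 1 (blockRotate D) := by
        have := blockRotate_shiftAvoid (m := k * (M + 1) - 1) hD (Or.inl rfl)
        rwa [Nat.sub_add_cancel (hkpos _)] at this
      obtain ⟨π, hπ⟩ := hG.exists_natVal
      refine ⟨⟨π, hG.congr hπ⟩, Set.ext fun d => ?_⟩
      have hlt : k * ((d : ℕ) + 1) < k * (M + 1) := by
        have := d.2
        exact Nat.mul_lt_mul_of_pos_left (by omega) (by omega)
      have hmem : k * ((d : ℕ) + 1) - 1 ∈ D ↔ d ∈ S := by
        constructor
        · rintro (h | ⟨e, he, h⟩)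
          · have := hkpos d
            omega
          · have h1 := hkpos d
            have h2 := hkpos e
            have h3 := Nat.eq_of_mul_eq_mul_left (show 0 < k by omega)
              (show k * ((d : ℕ) + 1) = k * ((e : ℕ) + 1) by omega)
            rwa [show d = e from Fin.ext (by omega)]
        · exact fun h => Or.inr ⟨d, h, rfl⟩
      have := hkpos d
      simp only [F, Set.mem_ofPred_eq]
      rw [hπ _ (by omega), ← hmem]
      by_cases h : k * ((d : ℕ) + 1) - 1 ∈ D
      · have := blockRotate_le_of_mem h
        simp only [h, iff_true]
        omega
      · simp only [h, blockRotate_of_notMem h, iff_false]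
        omega
  rw [Nat.card_eq_of_bijective F hF]
  simp

theorem mp312_with_remainder (k n r : ℕ) (hk : 3 ≤ k) (hn : 1 ≤ n)
    (hr1 : 1 ≤ r) (hrk : r ≤ k) :
    mpPatR k r pat312 n =
      (if r = 1 then 1 else if r = 2 ∧ k ∣ n then 2 ^ (n / k - 1) else 0) ∧
    (r = 1 → ∀ π : Equiv.Perm (Fin n),
      (ModKAltR k r π ∧ ¬ Pattern3 pat312 π) ↔ π = 1) := by
  have hid : r = 1 → ∀ π : Equiv.Perm (Fin n),
      (ModKAltR k r π ∧ ¬ Pattern3 pat312 π) ↔ π = 1 := by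
    rintro rfl π
    have hone : ∀ i < n, natVal (1 : Equiv.Perm (Fin n)) i = i :=
      fun i hi => by simp [natVal_of_lt _ hi]
    rw [← shiftAvoid_natVal_iff le_rfl]
    constructor
    · intro h
      exact natVal_ext fun i hi => (h.eq_self hk i hi).trans (hone i hi).symm
    · rintro rfl
      exact (shiftAvoid_id k n).congr hone
  refine ⟨?_, hid⟩
  unfold mpPatR
  split_ifs with h1 h2
  · simp [hid h1]
  · obtain ⟨rfl, e, rfl⟩ := h2
    obtain _ | M := e
    · omega
    simp only [← shiftAvoid_natVal_iff hr1]
    rw [Nat.mul_div_cancel_left _ (by omega), Nat.add_sub_cancel]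
    exact card_shiftAvoid_one hk M
  · simp only [← shiftAvoid_natVal_iff hr1]
    rw [Nat.card_eq_zero]
    refine Or.inl ⟨fun ⟨π, h⟩ => ?_⟩
    obtain rfl | hr2 := eq_or_ne r 2
    · exact h2 ⟨rfl, h.dvd_of_pos (by omega) (by omega)⟩
    · have := h.eq_zero_of_two_le (by omega) (by omega)
      omega
end

section
/- Let n ≥ 2 and let π be a parity-alternating permutation of [n] (π(i) ≡ i (mod 2) for all i) that avoids the pattern 132. Then either the value n appears in π at a later position than the value n−1, or n is odd and π(1) = n. -/
open Finset

/-- Positions `i < j < k` with `π i < π k < π j` exhibit the pattern 132. -/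
theorem pattern3_pat132_of_lt {n : ℕ} {π : Equiv.Perm (Fin n)} {i j k : Fin n}
    (hij : i < j) (hjk : j < k) (hik : π i < π k) (hkj : π k < π j) :
    Pattern3 pat132 π := by
  refine ⟨![i, j, k], ?_, ?_⟩
  · rw [Fin.strictMono_iff_lt_succ]
    intro a
    fin_cases a
    · exact hij
    · exact hjk
  · have h0 : pat132 0 = 0 := by decide
    have h1 : pat132 1 = 2 := by decide
    have h2 : pat132 2 = 1 := by decide
    have hij' := hik.trans hkj
    intro a b
    fin_cases a <;> fin_cases b <;>
      simp [h0, h1, h2, hik, hkj, hij', hik.le, hkj.le, hij'.le]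

theorem pap132_structure (n : ℕ) (hn : 2 ≤ n) (π : Equiv.Perm (Fin n))
    (hpap : ModKAlt 2 π) (havoid : ¬ Pattern3 pat132 π) :
    π.symm ⟨n - 2, by omega⟩ < π.symm ⟨n - 1, by omega⟩ ∨
    (Odd n ∧ (π ⟨0, by omega⟩ : ℕ) = n - 1) := by
  by_contra! hcon
  obtain ⟨hle, hodd⟩ := hcon
  obtain ⟨p, hp⟩ := π.surjective ⟨n - 1, by omega⟩
  obtain ⟨q, hq⟩ := π.surjective ⟨n - 2, by omega⟩
  rw [← hp, ← hq, π.symm_apply_apply, π.symm_apply_apply] at hle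
  have hpq : p < q := by
    refine lt_of_le_of_ne hle ?_
    rintro rfl
    have := congrArg Fin.val (hp.symm.trans hq)
    simp only at this
    omega
  rcases Nat.eq_zero_or_pos (p : ℕ) with hp0 | hp0
  · have hp0' : p = ⟨0, by omega⟩ := Fin.ext hp0
    have hpar := hpap p
    rw [hp, hp0] at hpar
    refine hodd (Nat.odd_iff.2 ?_) (by rw [← hp0', hp])
    simp only at hpar
    omega
  · refine havoid (pattern3_pat132_of_lt (i := ⟨0, by omega⟩) hp0 hpq ?_ ?_)
    · have hne₁ : π ⟨0, by omega⟩ ≠ π p := fun h => by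
        have := congrArg Fin.val (π.injective h)
        simp only at this
        omega
      have hne₂ : π ⟨0, by omega⟩ ≠ π q := fun h => by
        have := congrArg Fin.val (π.injective h)
        simp only at this
        have : (p : ℕ) < q := hpq
        omega
      rw [hp, Ne, Fin.ext_iff] at hne₁
      rw [hq, Ne, Fin.ext_iff] at hne₂
      rw [hq, Fin.lt_def]
      have := (π ⟨0, by omega⟩).isLt
      simp only at hne₁ hne₂ ⊢
      omega
    · rw [hp, hq, Fin.lt_def]
      simp only
      omega
end

section
/- For every n ≥ 1, the number of parity-alternating permutations of [n] avoiding the pattern 132 equals the number of parity-alternating permutations of [n] avoiding the pattern 231; that is, p_{132}(n) = p_{231}(n) for all n (equivalently, p_{132}(2m) = p_{231}(2m) and p_{132}(2m+1) = p_{231}(2m+1) for all m ≥ 0). -/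
open Finset

namespace ParityAlternating

variable {r : ℕ → ℕ → Prop} {u v : ℕ → ℕ → ℕ}

/-- No triple `a, b, c` of entries, in this order, has `b` as its maximum and satisfies `r a c`. -/
def Avoids (r : ℕ → ℕ → Prop) (l : List ℕ) : Prop :=
  l.Triplewise fun a b c ↦ ¬ (a < b ∧ c < b ∧ r a c)

/-- The parities of the entries alternate, the first entry having the parity of `p`. -/
def Alternates : ℕ → List ℕ → Prop
  | _, [] => True
  | p, a :: l => a % 2 = p % 2 ∧ Alternates (p + 1) l

theorem alternates_append (p : ℕ) (L R : List ℕ) :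
    Alternates p (L ++ R) ↔ Alternates p L ∧ Alternates (p + L.length) R := by
  induction L generalizing p with
  | nil => simp [Alternates]
  | cons a L ih =>
    simp only [List.cons_append, Alternates, ih, List.length_cons, and_assoc]
    rw [show p + 1 + L.length = p + (L.length + 1) by ring]

theorem alternates_ofFn {n : ℕ} (p : ℕ) (f : Fin n → ℕ) :
    Alternates p (List.ofFn f) ↔ ∀ i, f i % 2 = (p + i) % 2 := by
  induction n generalizing p with
  | zero => simp [Alternates]
  | succ n ih =>
    simp only [List.ofFn_succ, Alternates, ih, Fin.forall_fin_succ, Fin.val_zero, add_zero,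
      Fin.val_succ, add_assoc, add_comm 1]

theorem avoids_append_cons {L R : List ℕ} {m : ℕ} (hL : ∀ a ∈ L, a < m) (hR : ∀ c ∈ R, c < m) :
    Avoids r (L ++ m :: R) ↔ Avoids r L ∧ Avoids r R ∧ ∀ a ∈ L, ∀ c ∈ R, ¬ r a c := by
  simp only [Avoids, List.triplewise_append, List.triplewise_cons, List.pairwise_cons,
    List.forall_mem_cons]
  constructor
  · rintro ⟨h1, ⟨-, h2⟩, h3, -⟩
    exact ⟨h1, h2, fun a ha c hc hr ↦ (h3 a ha).1 c hc ⟨hL a ha, hR c hc, hr⟩⟩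
  · rintro ⟨h1, h2, h3⟩
    refine ⟨h1, ⟨?_, h2⟩, fun a ha ↦ ⟨fun c hc h ↦ h3 a ha c hc h.2.2, ?_⟩, ?_, fun c hc ↦ ?_⟩
    · exact List.pairwise_of_forall_mem_list fun b hb c _ h ↦ (hR b hb).not_gt h.1
    · exact List.pairwise_of_forall_mem_list fun b _ c hc h ↦ h3 a ha c hc h.2.2
    · exact List.pairwise_of_forall_mem_list fun a _ b hb h ↦ (hL b hb).not_gt h.2.1
    · exact List.pairwise_of_forall_mem_list fun a ha b _ h ↦ h3 a ha c hc h.2.2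

open Classical in
/-- The arrangements of `s, …, s + n - 1` that avoid `r` and alternate in parity from `p`. -/
noncomputable def arrangements (r : ℕ → ℕ → Prop) (n p s : ℕ) : Finset (List ℕ) :=
  {l ∈ (List.range' s n).permutations.toFinset | Avoids r l ∧ Alternates p l}

theorem mem_arrangements {n p s : ℕ} {l : List ℕ} :
    l ∈ arrangements r n p s ↔ l.Perm (List.range' s n) ∧ Avoids r l ∧ Alternates p l := by
  simp [arrangements]

theorem length_of_mem {n p s : ℕ} {l : List ℕ} (h : l ∈ arrangements r n p s) : l.length = n := by
  simpa using (mem_arrangements.1 h).1.length_eq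

theorem card_arrangements_zero (p s : ℕ) : #(arrangements r 0 p s) = 1 := by
  rw [Finset.card_eq_one]
  refine ⟨[], ?_⟩
  ext l
  simp only [mem_arrangements, List.range'_zero, List.perm_nil, mem_singleton, and_iff_left_iff_imp]
  rintro rfl
  exact ⟨.nil, trivial⟩

/-- In an `r`-free concatenation `L ++ R` of an interval starting at `s`, the parts `L` and `R` are
intervals, shifted by `u` and `v` of their lengths. -/
def Splits (r : ℕ → ℕ → Prop) (u v : ℕ → ℕ → ℕ) : Prop :=
  ∀ (s : ℕ) (L R : List ℕ),
    ((L ++ R).Perm (List.range' s (L.length + R.length)) ∧ ∀ a ∈ L, ∀ c ∈ R, ¬ r a c) ↔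
      L.Perm (List.range' (s + u L.length R.length) L.length) ∧
        R.Perm (List.range' (s + v L.length R.length) R.length)

theorem splits_lt : Splits (· < ·) (fun _ j ↦ j) (fun _ _ ↦ 0) := by
  intro s L R
  constructor
  · rintro ⟨h, hLR⟩
    have hs : R.mergeSort ++ L.mergeSort =
        List.range' s R.length ++ List.range' (s + R.length) L.length := by
      rw [List.range'_append_1]
      refine List.Perm.eq_of_pairwise (le := (· ≤ ·)) (fun _ _ _ _ ↦ le_antisymm) ?_ ?_ ?_
      · rw [List.pairwise_append]
        refine ⟨List.pairwise_mergeSort' (· ≤ ·) R, List.pairwise_mergeSort' (· ≤ ·) L, ?_⟩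
        intro c hc a ha
        rw [List.mem_mergeSort] at hc ha
        exact not_lt.1 (hLR a ha c hc)
      · exact List.pairwise_le_range'
      · rw [add_comm R.length]
        exact ((R.mergeSort_perm _).append (L.mergeSort_perm _)).trans
          (List.perm_append_comm.trans h)
    obtain ⟨h1, h2⟩ := List.append_inj hs (by simp)
    exact ⟨h2 ▸ (L.mergeSort_perm _).symm, by simpa using! h1 ▸ (R.mergeSort_perm _).symm⟩
  · rintro ⟨hL, hR⟩
    refine ⟨?_, fun a ha c hc ↦ ?_⟩
    · rw [add_comm, ← List.range'_append_1]
      exact List.perm_append_comm.trans (hR.append hL)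
    · have := hL.mem_iff.1 ha
      have := hR.mem_iff.1 hc
      simp only [List.mem_range'_1] at *
      omega

theorem splits_gt : Splits (· > ·) (fun _ _ ↦ 0) (fun i _ ↦ i) := by
  intro s L R
  rw [and_comm (a := L.Perm _), ← splits_lt s R L, List.perm_append_comm.congr_left,
    add_comm R.length]
  exact and_congr_right fun _ ↦ ⟨fun h a ha c hc ↦ h c hc a ha, fun h a ha c hc ↦ h c hc a ha⟩

theorem append_cons_mem_arrangements (H : Splits r u v) {p s : ℕ} {L R : List ℕ} :
    L ++ (s + (L.length + R.length)) :: R ∈ arrangements r (L.length + R.length + 1) p s ↔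
      (p + L.length) % 2 = (s + (L.length + R.length)) % 2 ∧
        L ∈ arrangements r L.length p (s + u L.length R.length) ∧
        R ∈ arrangements r R.length (p + L.length + 1) (s + v L.length R.length) := by
  have hperm : (L ++ (s + (L.length + R.length)) :: R).Perm
      (List.range' s (L.length + R.length + 1)) ↔
      (L ++ R).Perm (List.range' s (L.length + R.length)) := by
    rw [List.range'_1_concat, List.perm_middle.congr_left,
      (List.perm_append_singleton _ _).congr_right, List.perm_cons]
  have key := H s L R
  simp only [mem_arrangements, hperm, alternates_append, Alternates]
  constructor
  · rintro ⟨h, hav, hA⟩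
    have hlt : ∀ a ∈ L ++ R, a < s + (L.length + R.length) := fun a ha ↦ by
      simpa using (List.mem_range'_1.1 (h.mem_iff.1 ha)).2
    rw [avoids_append_cons (fun a ha ↦ hlt a (by simp [ha])) (fun a ha ↦ hlt a (by simp [ha]))]
      at hav
    have := key.1 ⟨h, hav.2.2⟩
    exact ⟨hA.2.1.symm, ⟨this.1, hav.1, hA.1⟩, this.2, hav.2.1, hA.2.2⟩
  · rintro ⟨hp, ⟨hL, hLav, hLA⟩, hR, hRav, hRA⟩
    obtain ⟨h, hr⟩ := key.2 ⟨hL, hR⟩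
    have hlt : ∀ a ∈ L ++ R, a < s + (L.length + R.length) := fun a ha ↦ by
      simpa using (List.mem_range'_1.1 (h.mem_iff.1 ha)).2
    rw [avoids_append_cons (fun a ha ↦ hlt a (by simp [ha])) (fun a ha ↦ hlt a (by simp [ha]))]
    exact ⟨h, ⟨hLav, hRav, hr⟩, hLA, hp.symm, hRA⟩

theorem card_arrangements_succ (H : Splits r u v) (n p s : ℕ) :
    #(arrangements r (n + 1) p s) = ∑ k ∈ range (n + 1) with (p + k) % 2 = (s + n) % 2,
      #(arrangements r k p (s + u k (n - k))) *
        #(arrangements r (n - k) (p + k + 1) (s + v k (n - k))) := by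
  classical
  have hU : arrangements r (n + 1) p s =
      ({k ∈ range (n + 1) | (p + k) % 2 = (s + n) % 2}).biUnion fun k ↦
        (arrangements r k p (s + u k (n - k)) ×ˢ
          arrangements r (n - k) (p + k + 1) (s + v k (n - k))).image
            fun x ↦ x.1 ++ (s + n) :: x.2 := by
    ext l
    simp only [mem_biUnion, mem_filter, mem_range, mem_image, mem_product, Prod.exists]
    constructor
    · intro h
      have hm : s + n ∈ l := (mem_arrangements.1 h).1.mem_iff.2 (by simp)
      obtain ⟨L, R, rfl⟩ := List.append_of_mem hm
      have hn : L.length + R.length = n := by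
        have := length_of_mem h
        simp only [List.length_append, List.length_cons] at this
        omega
      subst hn
      rw [append_cons_mem_arrangements H] at h
      refine ⟨L.length, ⟨by omega, h.1⟩, L, R, ?_, rfl⟩
      simpa using h.2
    · rintro ⟨k, ⟨hk, hp⟩, L, R, ⟨hL, hR⟩, rfl⟩
      have h1 := length_of_mem hL
      have h2 := length_of_mem hR
      obtain rfl : L.length + R.length = n := by omega
      subst h1
      rw [append_cons_mem_arrangements H]
      simp only [add_tsub_cancel_left] at hL hR
      exact ⟨hp, hL, hR⟩
  rw [hU, card_biUnion]
  · refine sum_congr rfl fun k hk ↦ ?_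
    rw [card_image_of_injOn, card_product]
    rintro ⟨L, R⟩ h ⟨L', R'⟩ h' heq
    simp only [coe_product, Set.mem_prod, mem_coe] at h h'
    obtain ⟨h1, h2⟩ := List.append_inj heq (by rw [length_of_mem h.1, length_of_mem h'.1])
    simp_all
  · intro k hk k' hk' hne
    rw [Function.onFun, disjoint_left]
    intro l hl hl'
    have hmem : l ∈ arrangements r (n + 1) p s := hU ▸ mem_biUnion.2 ⟨k, hk, hl⟩
    have hnd := (mem_arrangements.1 hmem).1.nodup_iff.2 List.nodup_range'
    simp only [mem_image, mem_product, Prod.exists] at hl hl'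
    obtain ⟨L, R, ⟨hL, -⟩, rfl⟩ := hl
    obtain ⟨L', R', ⟨hL', -⟩, heq⟩ := hl'
    have idxOf_eq {A B : List ℕ} (h : (A ++ (s + n) :: B).Nodup) :
        (A ++ (s + n) :: B).idxOf (s + n) = A.length := by
      rw [List.idxOf_append_of_notMem, List.idxOf_cons_self, add_zero]
      exact fun hA ↦ (List.nodup_append.1 h).2.2 _ hA _ List.mem_cons_self rfl
    refine hne ?_
    rw [← length_of_mem hL, ← length_of_mem hL', ← idxOf_eq hnd, ← idxOf_eq (heq ▸ hnd), heq]

/-- The common number of parity-alternating permutations of size `n` avoiding 132 or 231. -/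
def count : ℕ → ℕ
  | 0 => 1
  | n + 1 => ∑ i : Fin (n + 1), if (i : ℕ) % 2 = 0 then count i * count (n - i) else 0

theorem count_succ (n : ℕ) :
    count (n + 1) = ∑ k ∈ range (n + 1) with k % 2 = 0, count k * count (n - k) := by
  rw [count, sum_filter, Finset.sum_range]

theorem count_succ' (n : ℕ) :
    count (n + 1) = ∑ k ∈ range (n + 1) with k % 2 = n % 2, count k * count (n - k) := by
  rw [count_succ, sum_filter, sum_filter, ← sum_range_reflect]
  refine sum_congr rfl fun k hk ↦ ?_
  have hk := mem_range.1 hk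
  rw [show n + 1 - 1 - k = n - k by omega, show n - (n - k) = k by omega, mul_comm]
  exact if_congr (by omega) rfl rfl

theorem sum_count_mul_count (n p s : ℕ) :
    (∑ k ∈ range (n + 1) with (p + k) % 2 = (s + n) % 2,
      if k % 2 = 0 ∨ (p + s) % 2 = 0 then count k * count (n - k) else 0) =
      if (n + 1) % 2 = 0 ∨ (p + s) % 2 = 0 then count (n + 1) else 0 := by
  rw [sum_filter]
  by_cases h : (p + s) % 2 = 0
  · rw [if_pos (.inr h), count_succ', sum_filter]
    refine sum_congr rfl fun k _ ↦ ?_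
    split_ifs <;> first | rfl | omega
  by_cases hn : n % 2 = 1
  · rw [if_pos (.inl (by omega)), count_succ, sum_filter]
    refine sum_congr rfl fun k _ ↦ ?_
    split_ifs <;> first | rfl | omega
  · rw [if_neg (by omega)]
    refine sum_eq_zero fun k _ ↦ ?_
    split_ifs <;> first | rfl | omega

theorem card_arrangements_lt (n p s : ℕ) :
    #(arrangements (· < ·) n p s) = if n % 2 = 0 ∨ (p + s) % 2 = 0 then count n else 0 := by
  induction n using Nat.strong_induction_on generalizing p s with
  | _ n ih =>
  obtain _ | n := n
  · simp [card_arrangements_zero, count]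
  rw [card_arrangements_succ splits_lt, ← sum_count_mul_count]
  refine sum_congr rfl fun k hk ↦ ?_
  simp only [mem_filter, mem_range] at hk
  rw [ih k hk.1, ih (n - k) (by omega), if_pos (by omega), mul_ite, mul_zero]
  exact if_congr (by omega) rfl rfl

theorem card_arrangements_gt (n p s : ℕ) :
    #(arrangements (· > ·) n p s) = if n % 2 = 0 ∨ (p + s) % 2 = 0 then count n else 0 := by
  induction n using Nat.strong_induction_on generalizing p s with
  | _ n ih =>
  obtain _ | n := n
  · simp [card_arrangements_zero, count]
  rw [card_arrangements_succ splits_gt, ← sum_count_mul_count]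
  refine sum_congr rfl fun k hk ↦ ?_
  simp only [mem_filter, mem_range] at hk
  rw [ih k hk.1, ih (n - k) (by omega), if_pos (c := _ ∨ (p + k + 1 + _) % 2 = 0) (by omega),
    add_zero, ite_mul, zero_mul]

theorem avoids_ofFn {n : ℕ} (f : Fin n → ℕ) :
    Avoids r (List.ofFn f) ↔
      ¬ ∃ i j k, i < j ∧ j < k ∧ f i < f j ∧ f k < f j ∧ r (f i) (f k) := by
  simp only [Avoids, List.triplewise_iff_getElem, List.length_ofFn, List.getElem_ofFn]
  constructor
  · rintro h ⟨i, j, k, hij, hjk, h1, h2, h3⟩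
    exact h i j k hij hjk k.2 ⟨h1, h2, h3⟩
  · rintro h i j k hij hjk hk ⟨h1, h2, h3⟩
    exact h ⟨⟨i, by omega⟩, ⟨j, by omega⟩, ⟨k, hk⟩, hij, hjk, h1, h2, h3⟩

theorem ofFn_perm_perm {n : ℕ} (π : Equiv.Perm (Fin n)) :
    (List.ofFn fun i ↦ (π i : ℕ)).Perm (List.range' 0 n) := by
  have h := π.ofFn_comp_perm (fun i ↦ (i : ℕ))
  rwa [show List.ofFn (fun i : Fin n ↦ (i : ℕ)) = List.range' 0 n by
    apply List.ext_getElem <;> simp] at h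

theorem exists_ofFn_eq {n : ℕ} {l : List ℕ} (h : l.Perm (List.range' 0 n)) :
    ∃ π : Equiv.Perm (Fin n), List.ofFn (fun i ↦ (π i : ℕ)) = l := by
  have hlen : l.length = n := by simpa using h.length_eq
  have hlt (i : Fin n) : l[i] < n := by
    simpa using List.mem_range'_1.1 (h.mem_iff.1 (l.getElem_mem (i.2.trans_eq hlen.symm)))
  have hinj : Function.Injective fun i : Fin n ↦ (⟨l[i], hlt i⟩ : Fin n) := fun i j hij ↦ by
    have hnd : l.Nodup := h.nodup_iff.2 List.nodup_range'
    simpa [hnd.getElem_inj_iff, Fin.val_inj] using hij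
  refine ⟨Equiv.ofBijective _ (Finite.injective_iff_bijective.1 hinj), ?_⟩
  apply List.ext_getElem <;> simp [hlen]

theorem mpPat_eq_card {σ : Equiv.Perm (Fin 3)} {n : ℕ}
    (hσ : ∀ π : Equiv.Perm (Fin n),
      Pattern3 σ π ↔ ∃ i j k, i < j ∧ j < k ∧ π i < π j ∧ π k < π j ∧ r (π i) (π k)) :
    mpPat 2 σ n = #(arrangements r n 0 0) := by
  have hmem (π : Equiv.Perm (Fin n)) : List.ofFn (fun i ↦ (π i : ℕ)) ∈ arrangements r n 0 0 ↔
      ModKAlt 2 π ∧ ¬ Pattern3 σ π := by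
    rw [mem_arrangements, avoids_ofFn, alternates_ofFn, hσ, ModKAlt, and_comm (a := ∀ _, _)]
    simp [ofFn_perm_perm]
  rw [mpPat, ← Nat.card_eq_finsetCard]
  refine Nat.card_congr (Equiv.ofBijective
    (fun π ↦ ⟨List.ofFn fun i ↦ (π.1 i : ℕ), (hmem π.1).2 π.2⟩) ⟨fun π π' h ↦ ?_, fun l ↦ ?_⟩)
  · ext i
    exact congrFun (List.ofFn_injective (Subtype.ext_iff.1 h)) i
  · obtain ⟨π, hπ⟩ := exists_ofFn_eq (mem_arrangements.1 l.2).1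
    exact ⟨⟨π, (hmem π).1 (hπ ▸ l.2)⟩, Subtype.ext hπ⟩

theorem pattern3_iff {n : ℕ} (σ : Equiv.Perm (Fin 3)) (π : Equiv.Perm (Fin n)) :
    Pattern3 σ π ↔ ∃ i j k, i < j ∧ j < k ∧
      ∀ a b, σ a < σ b ↔ π (![i, j, k] a) < π (![i, j, k] b) := by
  constructor
  · rintro ⟨f, hf, h⟩
    refine ⟨f 0, f 1, f 2, hf (by decide), hf (by decide), ?_⟩
    rwa [show ![f 0, f 1, f 2] = f from List.ofFn_injective rfl]
  · rintro ⟨i, j, k, hij, hjk, h⟩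
    refine ⟨_, ?_, h⟩
    simp [Fin.strictMono_iff_lt_succ, Fin.forall_fin_two, hij, hjk]

theorem pattern3_pat132_iff {n : ℕ} (π : Equiv.Perm (Fin n)) :
    Pattern3 pat132 π ↔ ∃ i j k, i < j ∧ j < k ∧ π i < π j ∧ π k < π j ∧ (π i : ℕ) < π k := by
  rw [pattern3_iff]
  refine exists₃_congr fun i j k ↦ and_congr_right fun _ ↦ and_congr_right fun _ ↦ ?_
  simp +decide [Fin.forall_fin_succ, pat132]
  omega

theorem pattern3_pat231_iff {n : ℕ} (π : Equiv.Perm (Fin n)) :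
    Pattern3 pat231 π ↔ ∃ i j k, i < j ∧ j < k ∧ π i < π j ∧ π k < π j ∧ (π i : ℕ) > π k := by
  rw [pattern3_iff]
  refine exists₃_congr fun i j k ↦ and_congr_right fun _ ↦ and_congr_right fun _ ↦ ?_
  simp +decide [Fin.forall_fin_succ, pat231]
  omega

end ParityAlternating

theorem pap_132_eq_231 (n : ℕ) (hn : 1 ≤ n) :
    mpPat 2 pat132 n = mpPat 2 pat231 n := by
  rw [ParityAlternating.mpPat_eq_card ParityAlternating.pattern3_pat132_iff,
    ParityAlternating.mpPat_eq_card ParityAlternating.pattern3_pat231_iff,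
    ParityAlternating.card_arrangements_lt, ParityAlternating.card_arrangements_gt]
end

section
/- Let k ≥ 2 and set r(n) := mp_C(n,k), the number of words (f_1,…,f_n) of positive integers with f_1 = 1, 1 ≤ f_i ≤ f_{i−1} + 1 for 2 ≤ i ≤ n, and f_i ≡ i (mod k) for all i ∈ [n] (with r(0) := 1). Then for all n ≥ 0, r(n+1) = Σ_{0 ≤ j ≤ n, k | j} r(j)·r(n−j). -/
/-- `mp_C(n,k)`: number of words `(f 1, …, f n)` of positive integers with `f 1 = 1`,
`1 ≤ f i ≤ f (i-1) + 1` for `2 ≤ i ≤ n`, and `f i ≡ i (mod k)` for all `i`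
(indices written 0-based via `Fin n`). -/
noncomputable def mpC (k n : ℕ) : ℕ :=
  Nat.card {f : Fin n → ℕ //
    (∀ i : Fin n, (i : ℕ) = 0 → f i = 1) ∧
    (∀ i : Fin n, 1 ≤ f i) ∧
    (∀ i j : Fin n, (j : ℕ) = (i : ℕ) + 1 → f j ≤ f i + 1) ∧
    (∀ i : Fin n, f i % k = ((i : ℕ) + 1) % k)}

/-- A word counted by `mpC k n`, with letters indexed from `0` and extended by `0` past `n`. -/
structure IsModWord (k n : ℕ) (f : ℕ → ℕ) : Prop where
  head : 0 < n → f 0 = 1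
  pos : ∀ i < n, 1 ≤ f i
  step : ∀ i, i + 1 < n → f (i + 1) ≤ f i + 1
  mod : ∀ i < n, f i ≡ i + 1 [MOD k]
  tail : ∀ i, n ≤ i → f i = 0

/-- The words counted by `mpC k n` are the extended words `IsModWord k n`. -/
def modWordEquiv (k n : ℕ) :
    {f : ℕ → ℕ // IsModWord k n f} ≃ {f : Fin n → ℕ //
      (∀ i : Fin n, (i : ℕ) = 0 → f i = 1) ∧
      (∀ i : Fin n, 1 ≤ f i) ∧
      (∀ i j : Fin n, (j : ℕ) = (i : ℕ) + 1 → f j ≤ f i + 1) ∧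
      (∀ i : Fin n, f i % k = ((i : ℕ) + 1) % k)} where
  toFun f := ⟨fun i => f.1 i, by
    obtain ⟨f, hf⟩ := f
    refine ⟨fun i hi => ?_, fun i => hf.pos i i.2, fun i j hij => ?_, fun i => hf.mod i i.2⟩
    · simpa [hi] using hf.head (by omega)
    · simpa [hij] using hf.step i (by omega)⟩
  invFun f := ⟨fun i => if h : i < n then f.1 ⟨i, h⟩ else 0, by
    obtain ⟨f, h₁, h₂, h₃, h₄⟩ := f
    refine ⟨fun h => ?_, fun i hi => ?_, fun i hi => ?_, fun i hi => ?_, fun i hi => ?_⟩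
    · simpa [h] using h₁ ⟨0, h⟩ rfl
    · simpa [hi] using h₂ ⟨i, hi⟩
    · simpa [hi, (by omega : i < n)] using h₃ ⟨i, by omega⟩ ⟨i + 1, hi⟩ rfl
    · simpa [hi, Nat.ModEq] using h₄ ⟨i, hi⟩
    · simp [Nat.not_lt.2 hi]⟩
  left_inv f := by
    ext i
    by_cases h : i < n
    · simp [h]
    · simp [h, f.2.tail i (by omega)]
  right_inv f := by
    ext i
    simp

lemma IsModWord.le_succ {k n : ℕ} {f : ℕ → ℕ} (hf : IsModWord k n f) (i : ℕ) (hi : i < n) :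
    f i ≤ i + 1 := by
  induction i with
  | zero => exact (hf.head hi).le
  | succ i ih =>
    have := hf.step i hi
    have := ih (by omega)
    omega

lemma finite_isModWord (k n : ℕ) : {f | IsModWord k n f}.Finite := by
  have : Finite {f : ℕ → ℕ // IsModWord k n f} := by
    refine Finite.of_injective
      (fun (f : {f : ℕ → ℕ // IsModWord k n f}) (i : Fin n) =>
        (⟨f.1 i, by have := f.2.le_succ i i.2; omega⟩ : Fin (n + 2))) fun f g hfg => ?_
    ext i
    by_cases h : i < n
    · simpa using congrFun hfg ⟨i, h⟩
    · rw [f.2.tail i (by omega), g.2.tail i (by omega)]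
  exact Set.finite_coe_iff.1 this

/-- The finite set of extended words of length `n`. -/
noncomputable def modWords (k n : ℕ) : Finset (ℕ → ℕ) := (finite_isModWord k n).toFinset

@[simp]
lemma mem_modWords {k n : ℕ} {f : ℕ → ℕ} : f ∈ modWords k n ↔ IsModWord k n f := by
  simp [modWords]

lemma mpC_eq_card_modWords (k n : ℕ) : mpC k n = (modWords k n).card := by
  rw [mpC, ← Nat.card_congr (modWordEquiv k n)]
  exact Nat.subtype_card _ fun _ => mem_modWords

/-- Concatenate a word of length `j`, the letter `1`, and a word of length `m` raised by `1`. -/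
def glueWords (j m : ℕ) (g h : ℕ → ℕ) (i : ℕ) : ℕ :=
  if i < j then g i else if i = j then 1 else if i ≤ j + m then h (i - (j + 1)) + 1 else 0

lemma isModWord_glueWords {k j m : ℕ} (hkj : k ∣ j) {g h : ℕ → ℕ}
    (hg : IsModWord k j g) (hh : IsModWord k m h) :
    IsModWord k (j + m + 1) (glueWords j m g h) := by
  have hj : j ≡ 0 [MOD k] := (Nat.modEq_zero_iff_dvd).2 hkj
  refine ⟨fun _ => ?_, fun i hi => ?_, fun i hi => ?_, fun i hi => ?_, fun i hi => ?_⟩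
  · rcases Nat.eq_zero_or_pos j with rfl | h0
    · simp [glueWords]
    · simp [glueWords, h0, hg.head h0]
  · have := hg.pos i
    unfold glueWords
    grind
  · rcases lt_trichotomy i j with hij | rfl | hij
    · have := hg.step i
      unfold glueWords
      grind
    · have := hh.head (by omega)
      simp [glueWords, this]
      grind
    · have := hh.step (i - (j + 1)) (by omega)
      rw [show i - (j + 1) + 1 = i + 1 - (j + 1) by omega] at this
      unfold glueWords
      grind
  · rcases lt_trichotomy i j with hij | rfl | hij
    · simpa [glueWords, hij] using hg.mod i hij
    · simpa [glueWords] using (hj.add_right 1).symm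
    · obtain ⟨l, rfl⟩ := Nat.exists_eq_add_of_lt hij
      have hl := (hh.mod l (by omega)).add_right 1
      have := (hj.add_right (l + 1 + 1)).symm
      rw [zero_add] at this
      have e : glueWords j m g h (j + l + 1) = h l + 1 := by
        have : j + l + 1 - (j + 1) = l := by omega
        unfold glueWords
        grind
      rw [e]
      exact (hl.trans this)
  · unfold glueWords
    grind

lemma glueWords_ne_one {k j m i : ℕ} {g h : ℕ → ℕ} (hh : IsModWord k m h) (hi : j < i) :
    glueWords j m g h i ≠ 1 := by
  have := hh.pos (i - (j + 1))
  unfold glueWords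
  grind

lemma IsModWord.take {k n j : ℕ} {f : ℕ → ℕ} (hf : IsModWord k n f) (hj : j ≤ n) :
    IsModWord k j (fun i => if i < j then f i else 0) := by
  refine ⟨fun h => ?_, fun i hi => ?_, fun i hi => ?_, fun i hi => ?_, fun i hi => ?_⟩
  · simpa [h] using hf.head (by omega)
  · simpa [hi] using hf.pos i (by omega)
  · simpa [hi, (by omega : i < j)] using hf.step i (by omega)
  · simpa [hi] using hf.mod i (by omega)
  · simp [Nat.not_lt.2 hi]

lemma IsModWord.drop {k j m : ℕ} {f : ℕ → ℕ} (hf : IsModWord k (j + m + 1) f) (hkj : k ∣ j)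
    (h1 : f j = 1) (hne : ∀ i, j < i → f i ≠ 1) :
    IsModWord k m (fun i => f (i + (j + 1)) - 1) := by
  have hj : j ≡ 0 [MOD k] := (Nat.modEq_zero_iff_dvd).2 hkj
  refine ⟨fun h => ?_, fun i hi => ?_, fun i hi => ?_, fun i hi => ?_, fun i hi => ?_⟩
  · have h₁ := hf.step j (by omega)
    have h₂ := hf.pos (j + 1) (by omega)
    have h₃ := hne (j + 1) (by omega)
    simp only [zero_add]
    omega
  · have h₂ := hf.pos (i + (j + 1)) (by omega)
    have h₃ := hne (i + (j + 1)) (by omega)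
    show 1 ≤ f (i + (j + 1)) - 1
    omega
  · have h₁ := hf.step (i + (j + 1)) (by omega)
    have h₂ := hf.pos (i + (j + 1)) (by omega)
    rw [show i + (j + 1) + 1 = i + 1 + (j + 1) by omega] at h₁
    show f (i + 1 + (j + 1)) - 1 ≤ f (i + (j + 1)) - 1 + 1
    omega
  · have h₁ := hf.mod (i + (j + 1)) (by omega)
    have h₂ := hf.pos (i + (j + 1)) (by omega)
    refine Nat.ModEq.add_right_cancel' 1 ?_
    rw [Nat.sub_add_cancel h₂]
    refine h₁.trans ?_
    have := hj.add_right (i + 1 + 1)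
    rw [zero_add] at this
    rwa [show i + (j + 1) + 1 = j + (i + 1 + 1) by omega]
  · simp [hf.tail (i + (j + 1)) (by omega)]

open Classical in
lemma card_modWords_last_one_eq {k j : ℕ} (hkj : k ∣ j) (m : ℕ) :
    ((modWords k (j + m + 1)).filter fun f => f j = 1 ∧ ∀ i, j < i → f i ≠ 1).card =
      (modWords k j).card * (modWords k m).card := by
  rw [← Finset.card_product]
  refine Finset.card_nbij'
    (fun f => (fun i => if i < j then f i else 0, fun i => f (i + (j + 1)) - 1))
    (fun p => glueWords j m p.1 p.2) ?_ ?_ ?_ ?_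
  · intro f hf
    simp only [Finset.coe_filter, mem_modWords, Set.mem_ofPred_eq] at hf
    obtain ⟨hf, h1, hne⟩ := hf
    simpa using ⟨hf.take (by omega), hf.drop hkj h1 hne⟩
  · rintro ⟨g, h⟩ hp
    simp only [Finset.coe_product, Set.mem_prod, Finset.mem_coe, mem_modWords] at hp
    simp only [Finset.coe_filter, mem_modWords, Set.mem_ofPred_eq]
    exact ⟨isModWord_glueWords hkj hp.1 hp.2, by simp [glueWords],
      fun i hi => glueWords_ne_one hp.2 hi⟩
  · intro f hf
    simp only [Finset.coe_filter, mem_modWords, Set.mem_ofPred_eq] at hf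
    obtain ⟨hf, h1, hne⟩ := hf
    funext i
    have h₁ := hf.pos i
    have h₂ := hf.tail i
    rcases lt_trichotomy i j with hij | rfl | hij
    · simp [glueWords, hij]
    · simp [glueWords, h1]
    · have : i - (j + 1) + (j + 1) = i := by omega
      simp only [glueWords, this]
      grind
  · rintro ⟨g, h⟩ hp
    simp only [Finset.coe_product, Set.mem_prod, Finset.mem_coe, mem_modWords] at hp
    refine Prod.ext (funext fun i => ?_) (funext fun i => ?_)
    · have := hp.1.tail i
      simp only [glueWords]
      grind
    · have := hp.2.tail i
      have : i + (j + 1) - (j + 1) = i := by omega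
      simp only [glueWords, this]
      grind

lemma findGreatest_eq_one_iff {k n j : ℕ} {f : ℕ → ℕ} (hf : IsModWord k (n + 1) f)
    (hj : j ≤ n) :
    Nat.findGreatest (fun i => f i = 1) n = j ↔ f j = 1 ∧ ∀ i, j < i → f i ≠ 1 := by
  rw [Nat.findGreatest_eq_iff]
  have h0 := hf.head (by omega)
  constructor
  · rintro ⟨-, h₁, h₂⟩
    refine ⟨?_, fun i hi => ?_⟩
    · by_cases h : j = 0
      · rwa [h]
      · exact h₁ h
    · by_cases h : i ≤ n
      · exact h₂ hi h
      · rw [hf.tail i (by omega)]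
        omega
  · rintro ⟨h₁, h₂⟩
    exact ⟨hj, fun _ => h₁, fun i hi _ => h₂ i hi⟩

lemma IsModWord.dvd_of_eq_one {k n j : ℕ} {f : ℕ → ℕ} (hf : IsModWord k n f) (hj : j < n)
    (h1 : f j = 1) : k ∣ j := by
  have := hf.mod j hj
  rw [h1] at this
  have h : 0 + 1 ≡ j + 1 [MOD k] := by simpa using this
  exact Nat.modEq_zero_iff_dvd.1 (Nat.ModEq.add_right_cancel' 1 h).symm

theorem mpC_recursion (k : ℕ) (hk : 2 ≤ k) :
    mpC k 0 = 1 ∧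
    ∀ n : ℕ, mpC k (n + 1) =
      ∑ j ∈ Finset.range (n + 1), if k ∣ j then mpC k j * mpC k (n - j) else 0 := by
  classical
  refine ⟨?_, fun n => ?_⟩
  · simp [mpC]
  · simp only [mpC_eq_card_modWords]
    rw [Finset.card_eq_sum_card_fiberwise
      (f := fun f : ℕ → ℕ => Nat.findGreatest (fun i => f i = 1) n) (t := Finset.range (n + 1))
      fun f _ => by simpa [Nat.lt_succ_iff] using Nat.findGreatest_le n]
    refine Finset.sum_congr rfl fun j hj => ?_
    have hjn : j ≤ n := by simpa [Nat.lt_succ_iff] using hj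
    rw [Finset.filter_congr fun f hf => findGreatest_eq_one_iff (mem_modWords.1 hf) hjn]
    split_ifs with hkj
    · obtain ⟨m, rfl⟩ := Nat.exists_eq_add_of_le hjn
      rw [Nat.add_sub_cancel_left, ← card_modWords_last_one_eq hkj m]
    · rw [Finset.card_eq_zero, Finset.filter_eq_empty_iff]
      rintro f hf ⟨h1, -⟩
      exact hkj ((mem_modWords.1 hf).dvd_of_eq_one (by omega) h1)
end
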